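/- Suppose m,n → ∞ with m/n → μ ∈ (0,∞), P^{(n)} → P weakly for some probability measure P on ℤ_+ × [0,1], and P^{(n)}_{rs} → P_{rs} ∈ (0,∞) for (r,s) = (1,0) and (2,1). Then the model bidegree distribution f_{2,n} converges weakly on ℤ_+² to the limiting bidegree distribution \bar f_2 = δ_{(1,1)} ∗ (\bar f_1 ⊗ \bar f_1) ∗ f'_2. -/

import Mathlib

open MeasureTheory ProbabilityTheory Filter
open scoped ENNReal Topology Classical

noncomputable section

/-- The binomial probability mass function `Bin(x,y)(s)`. -/
def binP (x : ℕ) (y : ℝ) (s : ℕ) : ℝ := (x.choose s : ℝ) * y ^ s * (1 - y) ^ (x - s)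

/-- Convolution of (mass) functions on `ℕ`. -/
def conv (f g : ℕ → ℝ) (s : ℕ) : ℝ := ∑ i ∈ Finset.range (s + 1), f i * g (s - i)

/-- Iterated convolution power: `convPow f j` is the `j`-fold convolution of `f`. -/
def convPow (f : ℕ → ℝ) : ℕ → ℕ → ℝ
  | 0 => fun s => if s = 0 then 1 else 0
  | j + 1 => conv f (convPow f j)

/-- The compound Poisson probability mass function `CPoi(lam, f)`, i.e. the law of
`H_1 + ⋯ + H_Λ` where `Λ ~ Poi(lam)` and the `H_k` are i.i.d. with mass function `f`,
independent of `Λ`. -/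
def cpoi (lam : ℝ) (f : ℕ → ℝ) (s : ℕ) : ℝ :=
  ∑' j : ℕ, Real.exp (-lam) * lam ^ j / (j.factorial : ℝ) * convPow f j s

/-- Convolution of (mass) functions on `ℕ × ℕ`. -/
def conv2 (F G : ℕ → ℕ → ℝ) (s t : ℕ) : ℝ :=
  ∑ i ∈ Finset.range (s + 1), ∑ j ∈ Finset.range (t + 1), F i j * G (s - i) (t - j)

/-- Point mass at `(1,1)`, as a mass function on `ℕ × ℕ`. -/
def delta11 (s t : ℕ) : ℝ := if s = 1 ∧ t = 1 then 1 else 0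

/-- The cross moment `Q_{rs} = E[(X)_r Y^s]` of a layer type distribution `Q`,
where `(x)_r` is the falling factorial. -/
def mom (Q : Measure (ℕ × ℝ)) (r s : ℕ) : ℝ :=
  ∫ p, (p.1.descFactorial r : ℝ) * p.2 ^ s ∂Q

/-- The increment distribution `g(s) = ∫ Bin(x-1,y)(s) x P(dx,dy) / P₁₀`. -/
def gInc (P : Measure (ℕ × ℝ)) (s : ℕ) : ℝ :=
  (∫ p, (p.1 : ℝ) * binP (p.1 - 1) p.2 s ∂P) / mom P 1 0

/-- The limiting degree distribution `\bar f_1 = CPoi(μ P₁₀, g)`. -/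
def barf1 (mu : ℝ) (P : Measure (ℕ × ℝ)) (s : ℕ) : ℝ :=
  cpoi (mu * mom P 1 0) (gInc P) s

/-- The distribution `f₂'` of `(D₁', D₂')`:
`f₂'(s,t) = ∫ Bin(x-2,y)(s) Bin(x-2,y)(t) (x)₂ y P(dx,dy) / P₂₁`. -/
def f2p (P : Measure (ℕ × ℝ)) (s t : ℕ) : ℝ :=
  (∫ p, (p.1.descFactorial 2 : ℝ) * p.2 * binP (p.1 - 2) p.2 s * binP (p.1 - 2) p.2 t ∂P) /
    mom P 2 1

/-- The limiting bidegree distribution `\bar f₂ = δ₍₁,₁₎ ∗ (\bar f₁ ⊗ \bar f₁) ∗ f₂'`. -/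
def barf2 (mu : ℝ) (P : Measure (ℕ × ℝ)) : ℕ → ℕ → ℝ :=
  conv2 (conv2 delta11 fun s t => barf1 mu P s * barf1 mu P t) (f2p P)

instance (n : ℕ) : MeasurableSpace (Finset (Fin n)) := ⊤

/-- Bernoulli distribution on `Bool` with success probability `y` (truncated into `[0,1]`). -/
def bern (y : ℝ) : Measure Bool :=
  (PMF.bernoulli (min (Real.toNNReal y) 1) (min_le_right _ _)).toMeasure

instance (y : ℝ) : IsProbabilityMeasure (bern y) :=
  PMF.toMeasure.isProbabilityMeasure _

/-- The distribution of the indicator of one potential edge `e` of a layer with node set `V`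
and strength `y`: Bernoulli(`y`) if `e` is a non-loop pair inside `V`, and surely absent
otherwise. -/
def edgeFactor (n : ℕ) (V : Finset (Fin n)) (y : ℝ) (e : Sym2 (Fin n)) : Measure Bool :=
  if ¬ e.IsDiag ∧ ∀ v ∈ e, v ∈ V then bern y else Measure.dirac false

instance (n : ℕ) (V : Finset (Fin n)) (y : ℝ) (e : Sym2 (Fin n)) :
    IsProbabilityMeasure (edgeFactor n V y e) := by
  unfold edgeFactor; split <;> infer_instance

/-- Conditionally on the node set `V` and strength `y`, each non-loop pair of nodes of `V`
is linked independently with probability `y`. -/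
def edgeMeasure (n : ℕ) (V : Finset (Fin n)) (y : ℝ) : Measure (Sym2 (Fin n) → Bool) :=
  Measure.pi fun e => edgeFactor n V y e

/-- Uniformly random subset of the `n` nodes of size `x`. -/
def vertexMeasure (n x : ℕ) : Measure (Finset (Fin n)) :=
  if h : (Finset.powersetCard x (Finset.univ : Finset (Fin n))).Nonempty then
    (PMF.uniformOfFinset _ h).toMeasure
  else Measure.dirac ∅

/-- A sampled layer: its type `(x,y)`, its node set, and its edge indicators. -/
abbrev Layer (n : ℕ) := (ℕ × ℝ) × Finset (Fin n) × (Sym2 (Fin n) → Bool)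

/-- The distribution of a single layer with type distribution `Q`: the type `(x,y)` is
sampled from `Q`; conditionally on it, the node set is a uniformly random subset of size
`x` of the `n` nodes, and each pair of nodes of the node set is linked independently with
probability `y`. -/
def layerMeasure (n : ℕ) (Q : Measure (ℕ × ℝ)) : Measure (Layer n) :=
  Q.bind fun xy =>
    (vertexMeasure n xy.1).bind fun V =>
      (edgeMeasure n V xy.2).map fun f => (xy, V, f)

instance (n x : ℕ) : IsProbabilityMeasure (vertexMeasure n x) := by
  unfold vertexMeasure; split <;> infer_instance

instance (n : ℕ) (V : Finset (Fin n)) (y : ℝ) : IsProbabilityMeasure (edgeMeasure n V y) := by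
  unfold edgeMeasure; infer_instance

theorem measure_bind_univ_le {α β : Type*} [MeasurableSpace α] [MeasurableSpace β]
    (Q : Measure α) [IsProbabilityMeasure Q] {f : α → Measure β}
    (hf : ∀ a, f a Set.univ ≤ 1) : Q.bind f Set.univ ≤ 1 := by
  rw [Measure.bind, Measure.join_apply MeasurableSet.univ]
  by_cases hmeas : AEMeasurable f Q
  · rw [lintegral_map' (Measure.measurable_coe MeasurableSet.univ).aemeasurable hmeas]
    calc ∫⁻ a, f a Set.univ ∂Q ≤ ∫⁻ _, 1 ∂Q := lintegral_mono hf
      _ = 1 := by simp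
  · rw [Measure.map_of_not_aemeasurable hmeas]; simp

instance (n : ℕ) (Q : Measure (ℕ × ℝ)) [IsProbabilityMeasure Q] :
    IsFiniteMeasure (layerMeasure n Q) := by
  refine ⟨lt_of_le_of_lt ?_ ENNReal.one_lt_top⟩
  refine measure_bind_univ_le Q fun xy => ?_
  refine measure_bind_univ_le _ fun V => ?_
  have hg : Measurable fun f : Sym2 (Fin n) → Bool => ((xy, V, f) : Layer n) :=
    measurable_const.prodMk (measurable_const.prodMk measurable_id)
  rw [Measure.map_apply hg MeasurableSet.univ]
  simp

/-- The Bernoulli random graph superposition model `G_n` with `n` nodes and `m` mutually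
independent layers, each with type distribution `Q`. -/
def modelMeasure (n m : ℕ) (Q : Measure (ℕ × ℝ)) [IsProbabilityMeasure Q] :
    Measure (Fin m → Layer n) :=
  Measure.pi fun _ => layerMeasure n Q

/-- The edge set `E(G_{n,k})` of one layer. -/
def layerEdges {n : ℕ} (L : Layer n) : Finset (Sym2 (Fin n)) :=
  Finset.univ.filter fun e => L.2.2 e = true ∧ ¬ e.IsDiag ∧ ∀ v ∈ e, v ∈ L.2.1

/-- The edge set `E(G_n) = ⋃ₖ E(G_{n,k})` of the superposition graph. -/
def graphEdges {n m : ℕ} (ω : Fin m → Layer n) : Finset (Sym2 (Fin n)) :=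
  Finset.univ.biUnion fun k => layerEdges (ω k)

/-- The degree `deg_{G_n}(i)` of the node with label `i` (labels start from `0`). -/
def deg {n m : ℕ} (ω : Fin m → Layer n) (i : ℕ) : ℕ :=
  ((graphEdges ω).filter fun e => ∃ v : Fin n, v ∈ e ∧ (v : ℕ) = i).card

/-- The event that the first two nodes (labels `0` and `1`) are adjacent in `G_n`. -/
def adjEvent (n m : ℕ) : Set (Fin m → Layer n) :=
  {ω | ∃ e ∈ graphEdges ω, (∃ v : Fin n, v ∈ e ∧ (v : ℕ) = 0) ∧ ∃ v : Fin n, v ∈ e ∧ (v : ℕ) = 1}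

/-- The model bidegree distribution
`f_{2,n}(s,t) = P(deg(1) = s, deg(2) = t ∣ {1,2} ∈ E(G_n))`. -/
def bidegree (n m : ℕ) (Q : Measure (ℕ × ℝ)) [IsProbabilityMeasure Q] (s t : ℕ) : ℝ :=
  ((modelMeasure n m Q)[|adjEvent n m] {ω | deg ω 0 = s ∧ deg ω 1 = t}).toReal

/-- Formal power series in two variables over `ℝ`. -/
abbrev BiSeries := PowerSeries (PowerSeries ℝ)

/-- The coefficient of `X ^ s * Y ^ t` in a two-variable power series. -/
def bicoeff (s t : ℕ) : BiSeries →+ ℝ :=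
  (PowerSeries.coeff (R := ℝ) t).toAddMonoidHom.comp
    (PowerSeries.coeff (R := PowerSeries ℝ) s).toAddMonoidHom

/-- Constant two-variable power series. -/
def scalar : ℝ →+* BiSeries := PowerSeries.C.comp PowerSeries.C

/-- One-variable power series viewed as series in the first variable. -/
def inX : PowerSeries ℝ →+* BiSeries := PowerSeries.map PowerSeries.C

/-- One-variable power series viewed as series in the second variable. -/
def inY : PowerSeries ℝ →+* BiSeries := PowerSeries.C

theorem bicoeff_def (s t : ℕ) (F : BiSeries) :
    bicoeff s t F = PowerSeries.coeff t (PowerSeries.coeff s F) := rfl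

theorem bicoeff_mul (s t : ℕ) (F G : BiSeries) :
    bicoeff s t (F * G) = ∑ i ∈ Finset.HasAntidiagonal.antidiagonal s, ∑ j ∈ Finset.HasAntidiagonal.antidiagonal t,
      bicoeff i.1 j.1 F * bicoeff i.2 j.2 G := by
  simp only [bicoeff_def, PowerSeries.coeff_mul, map_sum]

theorem bicoeff_scalar_mul (s t : ℕ) (r : ℝ) (F : BiSeries) :
    bicoeff s t (scalar r * F) = r * bicoeff s t F := by
  simp [bicoeff_def, scalar, PowerSeries.coeff_C_mul]

theorem bicoeff_inX_mul_inY (s t : ℕ) (f g : PowerSeries ℝ) :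
    bicoeff s t (inX f * inY g) = PowerSeries.coeff s f * PowerSeries.coeff t g := by
  simp [bicoeff_def, inX, inY, PowerSeries.coeff_mul_C, PowerSeries.coeff_C_mul]

theorem bicoeff_inX (s t : ℕ) (f : PowerSeries ℝ) :
    bicoeff s t (inX f) = PowerSeries.coeff s f * (if t = 0 then 1 else 0) := by
  simpa [PowerSeries.coeff_one] using bicoeff_inX_mul_inY s t f 1

theorem bicoeff_inY (s t : ℕ) (f : PowerSeries ℝ) :
    bicoeff s t (inY f) = (if s = 0 then 1 else 0) * PowerSeries.coeff t f := by
  simpa [PowerSeries.coeff_one] using bicoeff_inX_mul_inY s t 1 f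

theorem bicoeff_one (s t : ℕ) :
    bicoeff s t 1 = (if s = 0 then 1 else 0) * (if t = 0 then 1 else 0) := by
  simpa [PowerSeries.coeff_one] using bicoeff_inX_mul_inY s t 1 1

theorem bicoeff_scalar (s t : ℕ) (r : ℝ) :
    bicoeff s t (scalar r) = r * ((if s = 0 then 1 else 0) * (if t = 0 then 1 else 0)) := by
  rw [← bicoeff_one, ← bicoeff_scalar_mul, mul_one]

theorem tendsto_bicoeff_mul {ι : Type*} {l : Filter ι} {F G : ι → BiSeries} {F' G' : BiSeries}
    (hF : ∀ s t, Tendsto (fun n => bicoeff s t (F n)) l (𝓝 (bicoeff s t F')))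
    (hG : ∀ s t, Tendsto (fun n => bicoeff s t (G n)) l (𝓝 (bicoeff s t G'))) (s t : ℕ) :
    Tendsto (fun n => bicoeff s t (F n * G n)) l (𝓝 (bicoeff s t (F' * G'))) := by
  simp only [bicoeff_mul]
  exact tendsto_finsetSum _ fun i _ => tendsto_finsetSum _ fun j _ =>
    (hF _ _).mul (hG _ _)

theorem tendsto_bicoeff_pow {ι : Type*} {l : Filter ι} {F : ι → BiSeries} {F' : BiSeries}
    (hF : ∀ s t, Tendsto (fun n => bicoeff s t (F n)) l (𝓝 (bicoeff s t F'))) (j s t : ℕ) :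
    Tendsto (fun n => bicoeff s t (F n ^ j)) l (𝓝 (bicoeff s t (F' ^ j))) := by
  induction j generalizing s t with
  | zero => simpa only [pow_zero] using tendsto_const_nhds
  | succ j ih =>
    simp only [pow_succ]
    exact tendsto_bicoeff_mul ih hF s t

theorem bicoeff_pow_eq_zero {R : BiSeries} (hR : bicoeff 0 0 R = 0) {j s t : ℕ} (h : s + t < j) :
    bicoeff s t (R ^ j) = 0 := by
  induction j generalizing s t with
  | zero => omega
  | succ j ih =>
    rw [pow_succ, bicoeff_mul]
    refine Finset.sum_eq_zero fun p hp => Finset.sum_eq_zero fun q hq => ?_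
    rw [Finset.HasAntidiagonal.mem_antidiagonal] at hp hq
    by_cases h' : p.1 + q.1 < j
    · rw [ih h', zero_mul]
    · have h1 : p.2 = 0 := by omega
      have h2 : q.2 = 0 := by omega
      rw [h1, h2, hR, mul_zero]

theorem coeff_pow_eq_zero {f : PowerSeries ℝ} (hf : PowerSeries.coeff 0 f = 0) {j s : ℕ}
    (h : s < j) : PowerSeries.coeff s (f ^ j) = 0 := by
  have hX := bicoeff_pow_eq_zero (R := inX f) (by simp [bicoeff_inX, hf]) (j := j) (s := s) (t := 0)
    (by simpa using h)
  rw [← map_pow, bicoeff_inX] at hX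
  simpa using hX

/-- If `n (c n - 1) → w` and `k n / n → μ`, then `c n ^ (k n - j) → exp (μ w)`. -/
theorem tendsto_pow_sub_exp {c : ℕ → ℝ} {w mu : ℝ} {k : ℕ → ℕ} (hmu : 0 < mu)
    (hc : Tendsto (fun n : ℕ => (n : ℝ) * (c n - 1)) atTop (𝓝 w))
    (hk : Tendsto (fun n : ℕ => (k n : ℝ) / n) atTop (𝓝 mu)) (j : ℕ) :
    Tendsto (fun n => c n ^ (k n - j)) atTop (𝓝 (Real.exp (mu * w))) := by
  have hinv : Tendsto (fun n : ℕ => ((n : ℝ))⁻¹) atTop (𝓝 0) := tendsto_inv_atTop_nhds_zero_nat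
  have hc1 : Tendsto c atTop (𝓝 1) := by
    have h := (hinv.mul hc).add_const 1
    rw [zero_mul, zero_add] at h
    refine h.congr' ?_
    filter_upwards [eventually_gt_atTop 0] with n hn
    have : (n : ℝ) ≠ 0 := by positivity
    field_simp
    ring
  have hpos : ∀ᶠ n in atTop, 0 < c n := hc1.eventually (lt_mem_nhds one_pos)
  have hlog : Tendsto (fun n : ℕ => (n : ℝ) * Real.log (c n)) atTop (𝓝 w) := by
    have h := Real.tendsto_one_add_pow_exp_of_tendsto (g := fun n => c n - 1) hc
    have h2 := (Real.continuousAt_log (Real.exp_pos w).ne').tendsto.comp h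
    rw [Real.log_exp] at h2
    refine h2.congr fun n => ?_
    simp
  have hkj : Tendsto (fun n : ℕ => ((k n - j : ℕ) : ℝ) / n) atTop (𝓝 mu) := by
    have h := hk.sub (hinv.const_mul (j : ℝ))
    rw [mul_zero, sub_zero] at h
    refine h.congr' ?_
    have hbig : Tendsto (fun n : ℕ => (k n : ℝ) / n * n) atTop atTop :=
      hk.pos_mul_atTop hmu tendsto_natCast_atTop_atTop
    filter_upwards [hbig.eventually_ge_atTop (j : ℝ), eventually_gt_atTop 0] with n hn hn0
    have hn' : (n : ℝ) ≠ 0 := by positivity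
    rw [div_mul_cancel₀ _ hn'] at hn
    rw [Nat.cast_sub (by exact_mod_cast hn)]
    ring
  have h := Real.continuous_exp.continuousAt.tendsto.comp (hkj.mul hlog)
  refine h.congr' ?_
  filter_upwards [hpos, eventually_gt_atTop 0] with n hn hn0
  have hn' : (n : ℝ) ≠ 0 := by positivity
  simp only [Function.comp]
  rw [← mul_assoc, div_mul_cancel₀ _ hn', mul_comm, Real.exp_mul, Real.exp_log hn,
    Real.rpow_natCast]

theorem tendsto_choose_div_pow {mu : ℝ} {k : ℕ → ℕ} (hmu : 0 < mu)
    (hk : Tendsto (fun n : ℕ => (k n : ℝ) / n) atTop (𝓝 mu)) (j : ℕ) :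
    Tendsto (fun n : ℕ => ((k n).choose j : ℝ) / (n : ℝ) ^ j) atTop
      (𝓝 (mu ^ j / j.factorial)) := by
  have hbig : Tendsto k atTop atTop := by
    have hbig : Tendsto (fun n : ℕ => (k n : ℝ) / n * n) atTop atTop :=
      hk.pos_mul_atTop hmu tendsto_natCast_atTop_atTop
    rw [← tendsto_natCast_atTop_iff (R := ℝ)]
    refine hbig.congr' ?_
    filter_upwards [eventually_gt_atTop 0] with n hn0
    have hn' : (n : ℝ) ≠ 0 := by positivity
    rw [div_mul_cancel₀ _ hn']
  have h1 := ((isEquivalent_choose j).comp_tendsto hbig)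
  have h2 := h1.mul (Asymptotics.IsEquivalent.refl (u := fun n : ℕ => ((n : ℝ) ^ j)⁻¹) (l := atTop))
  refine (h2.symm.tendsto_nhds ?_).congr fun n => ?_
  · refine ((hk.pow j).div_const (j.factorial : ℝ)).congr fun n => ?_
    simp only [Pi.mul_apply, Function.comp, div_pow]
    ring
  · simp [Function.comp, div_eq_mul_inv]

theorem tendsto_bicoeff_pow_exp {G : ℕ → BiSeries} {W R : BiSeries} {w mu : ℝ} {k : ℕ → ℕ}
    (hmu : 0 < mu)
    (hG : ∀ s t, Tendsto (fun n : ℕ => (n : ℝ) * bicoeff s t (G n - 1)) atTop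
      (𝓝 (bicoeff s t W)))
    (hW : W = scalar w + R) (hR : bicoeff 0 0 R = 0)
    (hk : Tendsto (fun n : ℕ => (k n : ℝ) / n) atTop (𝓝 mu)) (s t : ℕ) :
    Tendsto (fun n => bicoeff s t (G n ^ k n)) atTop
      (𝓝 (∑ j ∈ Finset.range (s + t + 1),
        Real.exp (mu * w) * (mu ^ j / j.factorial) * bicoeff s t (R ^ j))) := by
  set c : ℕ → ℝ := fun n => bicoeff 0 0 (G n) with hcdef
  set r : ℕ → BiSeries := fun n => G n - scalar (c n) with hr
  have hc : Tendsto (fun n : ℕ => (n : ℝ) * (c n - 1)) atTop (𝓝 w) := by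
    have h := hG 0 0
    simpa [hW, hR, bicoeff_scalar, bicoeff_one, map_add, map_sub] using h
  have hr0 : ∀ n, bicoeff 0 0 (r n) = 0 := fun n => by
    simp [hr, hcdef, bicoeff_scalar, map_sub]
  have hrlim : ∀ s t, Tendsto (fun n : ℕ => bicoeff s t (scalar n * r n)) atTop
      (𝓝 (bicoeff s t R)) := by
    intro s t
    have h := (hG s t).sub (hc.mul_const ((if s = 0 then 1 else 0) * (if t = 0 then (1:ℝ) else 0)))
    have hR' : bicoeff s t W - w * ((if s = 0 then 1 else 0) * (if t = 0 then (1:ℝ) else 0)) =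
        bicoeff s t R := by
      rw [hW, map_add, bicoeff_scalar]; ring
    rw [hR'] at h
    refine h.congr fun n => ?_
    rw [bicoeff_scalar_mul, hr, map_sub, map_sub, bicoeff_scalar, bicoeff_one]
    ring
  have hterm : ∀ j, Tendsto (fun n : ℕ => ((k n).choose j : ℝ) * c n ^ (k n - j) *
      bicoeff s t (r n ^ j)) atTop
      (𝓝 (Real.exp (mu * w) * (mu ^ j / j.factorial) * bicoeff s t (R ^ j))) := by
    intro j
    have h := ((tendsto_pow_sub_exp hmu hc hk j).mul (tendsto_choose_div_pow hmu hk j)).mul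
      (tendsto_bicoeff_pow hrlim j s t)
    refine h.congr' ?_
    filter_upwards [eventually_gt_atTop 0] with n hn0
    have hn' : (n : ℝ) ≠ 0 := by positivity
    rw [mul_pow, ← map_pow scalar, bicoeff_scalar_mul]
    field_simp
  refine (tendsto_finsetSum _ fun j _ => hterm j).congr fun n => ?_
  have hGn : G n = r n + scalar (c n) := by simp [hr]
  rw [hGn, (Commute.all _ _).add_pow, map_sum]
  have hsum : ∀ j, bicoeff s t (r n ^ j * scalar (c n) ^ (k n - j) * ((k n).choose j : BiSeries)) =
      ((k n).choose j : ℝ) * c n ^ (k n - j) * bicoeff s t (r n ^ j) := by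
    intro j
    have hcast : ((k n).choose j : BiSeries) = scalar ((k n).choose j : ℝ) := by simp
    rw [hcast, ← map_pow scalar, mul_assoc, ← map_mul, mul_comm, bicoeff_scalar_mul]
    ring
  simp only [hsum]
  refine (Finset.sum_subset
    (Finset.range_mono (show s + t + 1 ≤ s + t + 1 + (k n + 1) by omega)) ?_).trans
    (Finset.sum_subset
      (Finset.range_mono (show k n + 1 ≤ s + t + 1 + (k n + 1) by omega)) ?_).symm
  · intro j _ hj
    rw [Finset.mem_range, not_lt] at hj
    rw [bicoeff_pow_eq_zero (hr0 n) (by omega), mul_zero]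
  · intro j _ hj
    rw [Finset.mem_range, not_lt] at hj
    rw [Nat.choose_eq_zero_of_lt (by omega)]
    simp

theorem convPow_eq_coeff (f : ℕ → ℝ) (j s : ℕ) :
    convPow f j s = PowerSeries.coeff s (PowerSeries.mk f ^ j) := by
  induction j generalizing s with
  | zero => simp [convPow, PowerSeries.coeff_one]
  | succ j ih =>
    rw [pow_succ', PowerSeries.coeff_mul, convPow, conv,
      Finset.Nat.sum_antidiagonal_eq_sum_range_succ_mk]
    exact Finset.sum_congr rfl fun i _ => by rw [ih, PowerSeries.coeff_mk]

theorem summable_norm_coeff_pow {h : PowerSeries ℝ} (h0 : PowerSeries.coeff 0 h = 0) (lam : ℝ)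
    (s : ℕ) : Summable fun i : ℕ => ‖lam ^ i / i.factorial * PowerSeries.coeff s (h ^ i)‖ := by
  refine summable_of_ne_finset_zero (s := Finset.range (s + 1)) fun i hi => ?_
  rw [Finset.mem_range, not_lt] at hi
  rw [coeff_pow_eq_zero h0 (by omega), mul_zero, norm_zero]

theorem choose_div_factorial {i l j : ℕ} (h : i + l = j) :
    ((j.choose i : ℕ) : ℝ) / j.factorial = 1 / i.factorial * (1 / l.factorial) := by
  subst h
  rw [Nat.cast_add_choose]
  have := Nat.factorial_ne_zero (i + l)
  field_simp

/-- The compound Poisson mass function with the atom of the increment at zero factored out. -/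
theorem cpoi_eq_tsum (lam g0 : ℝ) {g : ℕ → ℝ} {h : PowerSeries ℝ}
    (hg : PowerSeries.mk g = PowerSeries.C g0 + h) (h0 : PowerSeries.coeff 0 h = 0) (s : ℕ) :
    cpoi lam g s = Real.exp (-lam + lam * g0) *
      ∑' i : ℕ, lam ^ i / i.factorial * PowerSeries.coeff s (h ^ i) := by
  have hexp : ∑' l : ℕ, (lam * g0) ^ l / l.factorial = Real.exp (lam * g0) := by
    rw [Real.exp_eq_exp_ℝ, NormedSpace.exp_eq_tsum_div]
  rw [Real.exp_add, ← hexp, mul_assoc, mul_comm (∑' l : ℕ, (lam * g0) ^ l / l.factorial),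
    tsum_mul_tsum_eq_tsum_sum_antidiagonal_of_summable_norm (summable_norm_coeff_pow h0 lam s)
      (NormedSpace.norm_expSeries_div_summable (𝔸 := ℝ) (lam * g0)), ← tsum_mul_left, cpoi]
  refine tsum_congr fun j => ?_
  rw [convPow_eq_coeff, hg, add_comm, (Commute.all _ _).add_pow', map_sum, Finset.mul_sum,
    Finset.mul_sum]
  refine Finset.sum_congr rfl fun p hp => ?_
  rw [Finset.HasAntidiagonal.mem_antidiagonal] at hp
  have hch := choose_div_factorial hp
  rw [map_nsmul, ← map_pow PowerSeries.C, PowerSeries.coeff_mul_C, nsmul_eq_mul, mul_pow]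
  have : lam ^ j = lam ^ p.1 * lam ^ p.2 := by rw [← pow_add, hp]
  calc _ = Real.exp (-lam) * lam ^ j * (((j.choose p.1 : ℕ) : ℝ) / j.factorial) *
        (PowerSeries.coeff s (h ^ p.1) * g0 ^ p.2) := by ring
    _ = _ := by rw [hch, this]; ring

/-- Poisson limit: powers of a small perturbation of the identity converge to a product of two
compound Poisson mass functions. -/
theorem tendsto_bicoeff_pow_cpoi {G : ℕ → BiSeries} {g : ℕ → ℝ} {mu a : ℝ} {k : ℕ → ℕ}
    (hmu : 0 < mu)
    (hG : ∀ s t, Tendsto (fun n : ℕ => (n : ℝ) * bicoeff s t (G n - 1)) atTop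
      (𝓝 (bicoeff s t
        (scalar a * (inX (PowerSeries.mk g) - 1 + (inY (PowerSeries.mk g) - 1))))))
    (hk : Tendsto (fun n : ℕ => (k n : ℝ) / n) atTop (𝓝 mu)) (s t : ℕ) :
    Tendsto (fun n => bicoeff s t (G n ^ k n)) atTop
      (𝓝 (cpoi (mu * a) g s * cpoi (mu * a) g t)) := by
  set h : PowerSeries ℝ := PowerSeries.mk g - PowerSeries.C (g 0) with hh
  have h0 : PowerSeries.coeff 0 h = 0 := by simp [hh]
  have hg : PowerSeries.mk g = PowerSeries.C (g 0) + h := by simp [hh]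
  have hCX : inX (PowerSeries.C (g 0)) = scalar (g 0) := by simp [inX, scalar]
  have hCY : inY (PowerSeries.C (g 0)) = scalar (g 0) := by simp [inY, scalar]
  have hW : scalar a * (inX (PowerSeries.mk g) - 1 + (inY (PowerSeries.mk g) - 1)) =
      scalar (a * (2 * g 0 - 2)) + scalar a * (inX h + inY h) := by
    rw [hg, map_add, map_add, hCX, hCY]
    simp only [map_mul, map_sub, map_ofNat]
    ring
  have hR : bicoeff 0 0 (scalar a * (inX h + inY h)) = 0 := by
    rw [bicoeff_scalar_mul, map_add, bicoeff_inX, bicoeff_inY, h0]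
    simp
  convert tendsto_bicoeff_pow_exp hmu hG hW hR hk s t using 2
  rw [cpoi_eq_tsum (mu * a) (g 0) hg h0, cpoi_eq_tsum (mu * a) (g 0) hg h0,
    mul_mul_mul_comm, tsum_mul_tsum_eq_tsum_sum_antidiagonal_of_summable_norm
      (summable_norm_coeff_pow h0 _ s) (summable_norm_coeff_pow h0 _ t), ← Real.exp_add,
      ← tsum_mul_left]
  have hterm : ∀ j : ℕ, Real.exp (mu * (a * (2 * g 0 - 2))) * (mu ^ j / j.factorial) *
      bicoeff s t ((scalar a * (inX h + inY h)) ^ j) =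
      Real.exp (-(mu * a) + mu * a * g 0 + (-(mu * a) + mu * a * g 0)) *
      ∑ kl ∈ Finset.HasAntidiagonal.antidiagonal j,
        (mu * a) ^ kl.1 / kl.1.factorial * PowerSeries.coeff s (h ^ kl.1) *
        ((mu * a) ^ kl.2 / kl.2.factorial * PowerSeries.coeff t (h ^ kl.2)) := by
    intro j
    have he : mu * (a * (2 * g 0 - 2)) =
      -(mu * a) + mu * a * g 0 + (-(mu * a) + mu * a * g 0) := by ring
    rw [he, mul_assoc]
    congr 1
    rw [mul_pow, ← map_pow scalar, bicoeff_scalar_mul, (Commute.all _ _).add_pow', map_sum,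
      Finset.mul_sum, Finset.mul_sum]
    refine Finset.sum_congr rfl fun p hp => ?_
    rw [Finset.HasAntidiagonal.mem_antidiagonal] at hp
    have hch := choose_div_factorial hp
    rw [map_nsmul, ← map_pow inX, ← map_pow inY, bicoeff_inX_mul_inY, nsmul_eq_mul]
    have : (mu * a) ^ j = (mu * a) ^ p.1 * (mu * a) ^ p.2 := by rw [← pow_add, hp]
    calc _ = (mu * a) ^ j * (((j.choose p.1 : ℕ) : ℝ) / j.factorial) *
          (PowerSeries.coeff s (h ^ p.1) * PowerSeries.coeff t (h ^ p.2)) := by rw [mul_pow]; ring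
      _ = _ := by rw [hch, this]; ring
  rw [tsum_eq_sum (s := Finset.range (s + t + 1))]
  · exact Finset.sum_congr rfl fun j _ => (hterm j).symm
  · intro j hj
    rw [Finset.mem_range, not_lt] at hj
    rw [← hterm, bicoeff_pow_eq_zero hR (by omega), mul_zero]

/-- The real-valued indicator of a proposition. -/
def ind (p : Prop) : ℝ := if p then 1 else 0

theorem ind_true {p : Prop} (h : p) : ind p = 1 := if_pos h

theorem ind_false {p : Prop} (h : ¬p) : ind p = 0 := if_neg h

theorem ind_nonneg (p : Prop) : 0 ≤ ind p := by unfold ind; split <;> norm_num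

theorem ind_le_one (p : Prop) : ind p ≤ 1 := by unfold ind; split <;> norm_num

theorem ind_and (p q : Prop) : ind (p ∧ q) = ind p * ind q := by
  by_cases hp : p <;> by_cases hq : q <;> simp [ind, hp, hq]

section FiniteProduct

variable {Ω : Type*} [Fintype Ω]

/-- The mean of `f` under the weights `w`. -/
def mean (w : Ω → ℝ) (f : Ω → ℝ) : ℝ := ∑ e, w e * f e

/-- The mean of `F` under the `m`-fold product of the weights `w`. -/
def prodMean (w : Ω → ℝ) (m : ℕ) (F : (Fin m → Ω) → ℝ) : ℝ := ∑ E, (∏ k, w (E k)) * F E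

theorem sum_prod_apply {R : Type*} [CommSemiring R] {m : ℕ} (F : Fin m → Ω → R) :
    ∑ E : Fin m → Ω, ∏ k, F k (E k) = ∏ k, ∑ e, F k e := by
  rw [Finset.prod_univ_sum, Fintype.piFinset_univ]

variable {w : Ω → ℝ}

theorem mean_nonneg (hw : ∀ e, 0 ≤ w e) {f : Ω → ℝ} (hf : ∀ e, 0 ≤ f e) : 0 ≤ mean w f :=
  Finset.sum_nonneg fun e _ => mul_nonneg (hw e) (hf e)

theorem prodMean_mono (hw : ∀ e, 0 ≤ w e) {m : ℕ} {F G : (Fin m → Ω) → ℝ} (h : ∀ E, F E ≤ G E) :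
    prodMean w m F ≤ prodMean w m G :=
  Finset.sum_le_sum fun E _ =>
    mul_le_mul_of_nonneg_left (h E) (Finset.prod_nonneg fun _ _ => hw _)

theorem prodMean_sub {m : ℕ} (F G : (Fin m → Ω) → ℝ) :
    prodMean w m (fun E => F E - G E) = prodMean w m F - prodMean w m G := by
  simp [prodMean, mul_sub]

theorem prodMean_add {m : ℕ} (F G : (Fin m → Ω) → ℝ) :
    prodMean w m (fun E => F E + G E) = prodMean w m F + prodMean w m G := by
  simp [prodMean, mul_add, Finset.sum_add_distrib]

theorem prodMean_sum {m : ℕ} {ι : Type*} (s : Finset ι) (F : ι → (Fin m → Ω) → ℝ) :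
    prodMean w m (fun E => ∑ i ∈ s, F i E) = ∑ i ∈ s, prodMean w m (F i) := by
  simp only [prodMean, Finset.mul_sum]
  exact Finset.sum_comm

theorem abs_prodMean_sub_le (hw : ∀ e, 0 ≤ w e) {m : ℕ} {F G B : (Fin m → Ω) → ℝ}
    (h : ∀ E, |F E - G E| ≤ B E) : |prodMean w m F - prodMean w m G| ≤ prodMean w m B := by
  rw [← prodMean_sub, abs_le]
  constructor
  · have h1 : prodMean w m (fun E => 0 - B E) ≤ prodMean w m fun E => F E - G E :=
      prodMean_mono hw fun E => by have := (abs_le.1 (h E)).1; linarith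
    rw [prodMean_sub] at h1
    have h0 : prodMean w m (fun _ => 0) = 0 := by simp [prodMean]
    linarith
  · exact prodMean_mono hw fun E => (abs_le.1 (h E)).2

theorem prodMean_three (hw1 : ∑ e, w e = 1) {m : ℕ} {i j k : Fin m} (hij : i ≠ j) (hik : i ≠ k)
    (hjk : j ≠ k) (f g h : Ω → ℝ) :
    prodMean w m (fun E => f (E i) * g (E j) * h (E k)) = mean w f * mean w g * mean w h := by
  have hsplit : ∀ E : Fin m → Ω, (∏ l, w (E l)) * (f (E i) * g (E j) * h (E k)) =
      ∏ l, (w (E l) * (if l = i then f (E l) else 1) * (if l = j then g (E l) else 1) *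
        (if l = k then h (E l) else 1)) := by
    intro E
    simp only [Finset.prod_mul_distrib, Finset.prod_ite_eq', Finset.mem_univ, if_true]
    ring
  simp only [prodMean, hsplit]
  rw [sum_prod_apply (fun l e => w e * (if l = i then f e else 1) * (if l = j then g e else 1) *
        (if l = k then h e else 1))]
  have hl : ∀ l : Fin m, (∑ e, w e * (if l = i then f e else 1) * (if l = j then g e else 1) *
        (if l = k then h e else 1)) = (if l = i then mean w f else 1) *
        (if l = j then mean w g else 1) * (if l = k then mean w h else 1) := by
    intro l
    by_cases h1 : l = i
    · subst h1; simp [hij, hik, mean]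
    · by_cases h2 : l = j
      · subst h2; simp [h1, hjk, mean]
      · by_cases h3 : l = k
        · subst h3; simp [h1, h2, mean]
        · simp [h1, h2, h3, hw1]
  simp only [hl, Finset.prod_mul_distrib, Finset.prod_ite_eq', Finset.mem_univ, if_true]

theorem prodMean_two (hw1 : ∑ e, w e = 1) {m : ℕ} {i j : Fin m} (hij : i ≠ j) (f g : Ω → ℝ) :
    prodMean w m (fun E => f (E i) * g (E j)) = mean w f * mean w g := by
  have hsplit : ∀ E : Fin m → Ω, (∏ l, w (E l)) * (f (E i) * g (E j)) =
      ∏ l, (w (E l) * (if l = i then f (E l) else 1) * (if l = j then g (E l) else 1)) := by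
    intro E
    simp only [Finset.prod_mul_distrib, Finset.prod_ite_eq', Finset.mem_univ, if_true]
    ring
  simp only [prodMean, hsplit]
  rw [sum_prod_apply (fun l e => w e * (if l = i then f e else 1) * (if l = j then g e else 1))]
  have hl : ∀ l : Fin m, (∑ e, w e * (if l = i then f e else 1) * (if l = j then g e else 1)) =
      (if l = i then mean w f else 1) * (if l = j then mean w g else 1) := by
    intro l
    by_cases h1 : l = i
    · subst h1; simp [hij, mean]
    · by_cases h2 : l = j
      · subst h2; simp [h1, mean]
      · simp [h1, h2, hw1]
  simp only [hl, Finset.prod_mul_distrib, Finset.prod_ite_eq', Finset.mem_univ, if_true]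

theorem prodMean_one (hw1 : ∑ e, w e = 1) {m : ℕ} (i : Fin m) (f : Ω → ℝ) :
    prodMean w m (fun E => f (E i)) = mean w f := by
  have hsplit : ∀ E : Fin m → Ω, (∏ l, w (E l)) * (f (E i)) =
      ∏ l, (w (E l) * (if l = i then f (E l) else 1)) := by
    intro E
    simp only [Finset.prod_mul_distrib, Finset.prod_ite_eq', Finset.mem_univ, if_true]
  simp only [prodMean, hsplit]
  rw [sum_prod_apply (fun l e => w e * (if l = i then f e else 1))]
  have hl : ∀ l : Fin m, (∑ e, w e * (if l = i then f e else 1)) =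
      (if l = i then mean w f else 1) := by
    intro l
    by_cases h1 : l = i
    · subst h1; simp [mean]
    · simp [h1, hw1]
  simp only [hl, Finset.prod_ite_eq', Finset.mem_univ, if_true]

/-- The monomial `X ^ i * Y ^ j`. -/
def monom (i j : ℕ) : BiSeries := inX (PowerSeries.X ^ i) * inY (PowerSeries.X ^ j)

theorem bicoeff_monom (s t i j : ℕ) : bicoeff s t (monom i j) = ind (i = s ∧ j = t) := by
  rw [monom, bicoeff_inX_mul_inY, PowerSeries.coeff_X_pow, PowerSeries.coeff_X_pow, ind_and]
  simp only [ind, eq_comm]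

theorem prod_monom {ι : Type*} (s : Finset ι) (A B : ι → ℕ) :
    ∏ k ∈ s, monom (A k) (B k) = monom (∑ k ∈ s, A k) (∑ k ∈ s, B k) := by
  simp only [monom, Finset.prod_mul_distrib, ← map_prod, Finset.prod_pow_eq_pow_sum]

/-- The joint generating function of `A` and `B` weighted with `f`. -/
def jointGF (w : Ω → ℝ) (A B : Ω → ℕ) (f : Ω → ℝ) : BiSeries :=
  ∑ e, scalar (w e * f e) * monom (A e) (B e)

theorem bicoeff_jointGF (A B : Ω → ℕ) (f : Ω → ℝ) (s t : ℕ) :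
    bicoeff s t (jointGF w A B f) = mean w fun e => f e * ind (A e = s ∧ B e = t) := by
  simp only [jointGF, map_sum, bicoeff_scalar_mul, bicoeff_monom, mean, mul_assoc]

theorem prodMean_jointGF {m : ℕ} (i : Fin m) (A B : Ω → ℕ) (f : Ω → ℝ) (s t : ℕ) :
    prodMean w m (fun E => f (E i) * ind ((∑ k, A (E k)) = s ∧ (∑ k, B (E k)) = t)) =
      bicoeff s t (jointGF w A B f * jointGF w A B (fun _ => 1) ^ (m - 1)) := by
  have hprod : jointGF w A B f * jointGF w A B (fun _ => 1) ^ (m - 1) =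
      ∏ k : Fin m, jointGF w A B (if k = i then f else fun _ => 1) := by
    rw [← Finset.mul_prod_erase _ _ (Finset.mem_univ i), if_pos rfl]
    congr 1
    rw [Finset.prod_congr rfl (g := fun _ => jointGF w A B (fun _ => 1)) fun k hk => by
      rw [if_neg (Finset.ne_of_mem_erase hk)]]
    rw [Finset.prod_const, Finset.card_erase_of_mem (Finset.mem_univ i), Finset.card_univ,
      Fintype.card_fin]
  rw [hprod]
  simp only [jointGF]
  rw [← sum_prod_apply, map_sum]
  refine Finset.sum_congr rfl fun E _ => ?_
  rw [Finset.prod_mul_distrib, ← map_prod, bicoeff_scalar_mul, prod_monom, bicoeff_monom,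
    Finset.prod_mul_distrib]
  have hf : ∏ k, (if k = i then f else fun _ => 1) (E k) = f (E i) := by
    rw [← Finset.mul_prod_erase _ _ (Finset.mem_univ i), if_pos rfl,
      Finset.prod_eq_one fun k hk => by rw [if_neg (Finset.ne_of_mem_erase hk)], mul_one]
  rw [hf, mul_assoc]

end FiniteProduct

section Superposition

variable {n : ℕ}

/-- The degree of `v` in the graph with edge set `E`. -/
def edgeDeg (v : Fin n) (E : Finset (Sym2 (Fin n))) : ℕ := (E.filter fun e => v ∈ e).card

/-- Pairs different from `{a, b}` that contain `a` or `b`. -/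
def touching (a b : Fin n) : Finset (Sym2 (Fin n)) :=
  Finset.univ.filter fun e => e ≠ s(a, b) ∧ (a ∈ e ∨ b ∈ e)

theorem card_touching_le (a b : Fin n) : (touching a b).card ≤ 2 * n := by
  have h : touching a b ⊆ (Finset.univ.image fun v => s(a, v)) ∪
      (Finset.univ.image fun v => s(b, v)) := by
    intro e he
    simp only [touching, Finset.mem_filter, Finset.mem_univ, true_and] at he
    simp only [Finset.mem_union, Finset.mem_image, Finset.mem_univ, true_and]
    rcases he.2 with h | h
    · obtain ⟨v, rfl⟩ := Sym2.mem_iff_exists.1 h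
      exact Or.inl ⟨v, rfl⟩
    · obtain ⟨v, rfl⟩ := Sym2.mem_iff_exists.1 h
      exact Or.inr ⟨v, rfl⟩
  refine (Finset.card_le_card h).trans ((Finset.card_union_le _ _).trans ?_)
  have h1 := Finset.card_image_le (s := Finset.univ) (f := fun v : Fin n => s(a, v))
  have h2 := Finset.card_image_le (s := Finset.univ) (f := fun v : Fin n => s(b, v))
  simp only [Finset.card_univ, Fintype.card_fin] at h1 h2
  omega

/-- Number of configurations in which two distinct layers share `{a, b}`, or `{a, b}` is covered
and two distinct layers share a pair touching it. -/
def overlap {m : ℕ} (a b : Fin n) (E : Fin m → Finset (Sym2 (Fin n))) : ℝ :=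
  (∑ k, ∑ l ∈ Finset.univ.erase k, ind (s(a, b) ∈ E k) * ind (s(a, b) ∈ E l)) +
  ∑ k, ∑ l ∈ Finset.univ.erase k, ∑ e ∈ touching a b,
    (ind (s(a, b) ∈ E k ∧ e ∈ E k) * ind (e ∈ E l) +
      ∑ j ∈ (Finset.univ.erase k).erase l,
        ind (s(a, b) ∈ E j) * ind (e ∈ E k) * ind (e ∈ E l))

theorem le_overlap_pairs {m : ℕ} (a b : Fin n) (E : Fin m → Finset (Sym2 (Fin n))) :
    (∑ k, ind (s(a, b) ∈ E k)) * (∑ k, ind (s(a, b) ∈ E k)) - ∑ k, ind (s(a, b) ∈ E k) ≤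
      overlap a b E := by
  have h : ∀ k, ∑ l ∈ Finset.univ.erase k, ind (s(a, b) ∈ E k) * ind (s(a, b) ∈ E l) =
      ind (s(a, b) ∈ E k) * (∑ l, ind (s(a, b) ∈ E l)) - ind (s(a, b) ∈ E k) := by
    intro k
    rw [← Finset.mul_sum, ← Finset.add_sum_erase _ _ (Finset.mem_univ k), mul_add, ← ind_and,
      and_self]
    ring
  unfold overlap
  rw [Finset.sum_congr rfl fun k _ => h k, Finset.sum_sub_distrib, ← Finset.sum_mul]
  refine le_add_of_nonneg_right (Finset.sum_nonneg fun k _ => Finset.sum_nonneg fun l _ =>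
    Finset.sum_nonneg fun e _ => add_nonneg (mul_nonneg (ind_nonneg _) (ind_nonneg _))
      (Finset.sum_nonneg fun j _ =>
        mul_nonneg (mul_nonneg (ind_nonneg _) (ind_nonneg _)) (ind_nonneg _)))

theorem one_le_overlap {m : ℕ} {a b : Fin n} {E : Fin m → Finset (Sym2 (Fin n))} {j k l : Fin m}
    (hkl : k ≠ l) {e : Sym2 (Fin n)} (he : e ∈ touching a b) (hj : s(a, b) ∈ E j) (hk : e ∈ E k)
    (hl : e ∈ E l) : 1 ≤ overlap a b E := by
  have key : ∀ k l : Fin m, k ≠ l → e ∈ E k → e ∈ E l → j ≠ l → 1 ≤ overlap a b E := by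
    intro k l hkl hk hl hjl
    have hpos1 : ∀ k l : Fin m, 0 ≤ ind (s(a, b) ∈ E k) * ind (s(a, b) ∈ E l) :=
      fun k l => mul_nonneg (ind_nonneg _) (ind_nonneg _)
    have hpos3 : ∀ (k l : Fin m) (e), ∀ i ∈ (Finset.univ.erase k).erase l,
        0 ≤ ind (s(a, b) ∈ E i) * ind (e ∈ E k) * ind (e ∈ E l) := fun k l e i _ =>
      mul_nonneg (mul_nonneg (ind_nonneg _) (ind_nonneg _)) (ind_nonneg _)
    have hpos2 : ∀ (k l : Fin m), ∀ e ∈ touching a b, 0 ≤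
      (ind (s(a, b) ∈ E k ∧ e ∈ E k) * ind (e ∈ E l) +
      ∑ j ∈ (Finset.univ.erase k).erase l,
        ind (s(a, b) ∈ E j) * ind (e ∈ E k) * ind (e ∈ E l)) := fun k l e _ =>
      add_nonneg (mul_nonneg (ind_nonneg _) (ind_nonneg _)) (Finset.sum_nonneg (hpos3 k l e))
    refine le_trans ?_ (le_add_of_nonneg_left (Finset.sum_nonneg fun k _ =>
      Finset.sum_nonneg fun l _ => hpos1 k l))
    refine le_trans ?_ (Finset.single_le_sum (fun k _ => Finset.sum_nonneg fun l _ =>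
      Finset.sum_nonneg (hpos2 k l)) (Finset.mem_univ k))
    refine le_trans ?_ (Finset.single_le_sum (fun l _ => Finset.sum_nonneg (hpos2 k l))
      (Finset.mem_erase.2 ⟨hkl.symm, Finset.mem_univ l⟩))
    refine le_trans ?_ (Finset.single_le_sum (hpos2 k l) he)
    by_cases hjk : j = k
    · subst hjk
      have hs := Finset.sum_nonneg (hpos3 j l e)
      rw [ind_true (show s(a, b) ∈ E j ∧ e ∈ E j from ⟨hj, hk⟩), ind_true hl] at *
      linarith
    · refine le_trans ?_ (le_add_of_nonneg_left (mul_nonneg (ind_nonneg _) (ind_nonneg _)))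
      refine le_trans ?_ (Finset.single_le_sum (hpos3 k l e)
        (Finset.mem_erase.2 ⟨hjl, Finset.mem_erase.2 ⟨hjk, Finset.mem_univ j⟩⟩))
      rw [ind_true hj, ind_true hk, ind_true hl]
      norm_num
  by_cases hjl : j = l
  · exact key l k hkl.symm hl hk (by rw [hjl]; exact hkl.symm)
  · exact key k l hkl hk hl hjl

theorem edgeDeg_biUnion {m : ℕ} {v : Fin n} {E : Fin m → Finset (Sym2 (Fin n))}
    (h : ∀ k l, k ≠ l → ∀ e, v ∈ e → e ∈ E k → e ∉ E l) :
    edgeDeg v (Finset.univ.biUnion E) = ∑ k, edgeDeg v (E k) := by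
  unfold edgeDeg
  rw [Finset.filter_biUnion, Finset.card_biUnion]
  intro k _ l _ hkl
  refine Finset.disjoint_left.2 fun e hk hl => ?_
  rw [Finset.mem_filter] at hk hl
  exact h k l hkl e hk.2 hk.1 hl.1

theorem abs_ind_adj_sub_le {m : ℕ} (a b : Fin n) (E : Fin m → Finset (Sym2 (Fin n)))
    {x y : Prop}
    (hxy : (Finset.univ.filter fun k => s(a, b) ∈ E k).card = 1 → ¬(x ↔ y) →
      1 ≤ overlap a b E) :
    |ind (s(a, b) ∈ Finset.univ.biUnion E ∧ x) - ∑ k, ind (s(a, b) ∈ E k) * ind y| ≤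
      overlap a b E := by
  have hpairs := le_overlap_pairs a b E
  have hN : ∑ k, ind (s(a, b) ∈ E k) =
      ((Finset.univ.filter fun k => s(a, b) ∈ E k).card : ℝ) := by
    rw [Finset.card_filter]
    push_cast
    exact Finset.sum_congr rfl fun k _ => by by_cases h : s(a, b) ∈ E k <;> simp [ind, h]
  rw [← Finset.sum_mul]
  rw [hN] at hpairs ⊢
  set N := (Finset.univ.filter fun k => s(a, b) ∈ E k).card with hNdef
  have hx0 := ind_nonneg x
  have hx1 := ind_le_one x
  have hy0 := ind_nonneg y
  have hy1 := ind_le_one y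
  rcases Nat.eq_zero_or_pos N with h0 | hpos
  · have hnot : ¬ s(a, b) ∈ Finset.univ.biUnion E := by
      intro h
      obtain ⟨k, _, hk⟩ := Finset.mem_biUnion.1 h
      rw [hNdef, Finset.card_eq_zero, Finset.filter_eq_empty_iff] at h0
      exact h0 (Finset.mem_univ k) hk
    rw [ind_false fun h => hnot h.1]
    rw [h0] at hpairs ⊢
    simpa using hpairs
  · have hadj : s(a, b) ∈ Finset.univ.biUnion E := by
      obtain ⟨k, hk⟩ := Finset.card_pos.1 (hNdef ▸ hpos)
      exact Finset.mem_biUnion.2 ⟨k, Finset.mem_univ k, (Finset.mem_filter.1 hk).2⟩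
    rw [ind_and, ind_true hadj, one_mul]
    rcases Nat.lt_or_ge 1 N with h2 | h1
    · have h2' : (2 : ℝ) ≤ N := by exact_mod_cast h2
      rw [abs_le]
      constructor <;> nlinarith
    · have hN1 : N = 1 := by omega
      rw [hN1] at hpairs ⊢
      by_cases h : x ↔ y
      · simp only [h]
        simpa using hpairs
      · refine le_trans ?_ (hxy hN1 h)
        rw [abs_le]
        constructor <;> push_cast <;> linarith

theorem abs_ind_deg_sub_le {m : ℕ} (a b : Fin n) (E : Fin m → Finset (Sym2 (Fin n))) (s t : ℕ) :
    |ind (s(a, b) ∈ Finset.univ.biUnion E ∧ edgeDeg a (Finset.univ.biUnion E) = s ∧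
        edgeDeg b (Finset.univ.biUnion E) = t) -
      ∑ k, ind (s(a, b) ∈ E k) *
        ind (∑ k, edgeDeg a (E k) = s ∧ ∑ k, edgeDeg b (E k) = t)| ≤ overlap a b E := by
  refine abs_ind_adj_sub_le a b E fun hcard hne => ?_
  by_contra hov
  obtain ⟨j, hj⟩ := Finset.card_eq_one.1 hcard
  have hjmem : s(a, b) ∈ E j := by
    have : j ∈ Finset.univ.filter fun k => s(a, b) ∈ E k := by simp [hj]
    exact (Finset.mem_filter.1 this).2
  have huniq : ∀ k, s(a, b) ∈ E k → k = j := fun k hk => by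
    have : k ∈ Finset.univ.filter fun k => s(a, b) ∈ E k := by simp [hk]
    rw [hj, Finset.mem_singleton] at this
    exact this
  have hdisj : ∀ k l, k ≠ l → ∀ e : Sym2 (Fin n), (a ∈ e ∨ b ∈ e) → e ∈ E k → e ∉ E l := by
    intro k l hkl e he hk hl
    by_cases hab : e = s(a, b)
    · subst hab
      exact hkl ((huniq k hk).trans (huniq l hl).symm)
    · exact hov (one_le_overlap hkl
        (Finset.mem_filter.2 ⟨Finset.mem_univ e, hab, he⟩) hjmem hk hl)
  refine hne ?_
  rw [edgeDeg_biUnion fun k l hkl e he => hdisj k l hkl e (Or.inl he),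
    edgeDeg_biUnion fun k l hkl e he => hdisj k l hkl e (Or.inr he)]

theorem prodMean_overlap_le {m : ℕ} {w : Finset (Sym2 (Fin n)) → ℝ} (hw : ∀ E, 0 ≤ w E)
    (hw1 : ∑ E, w E = 1) {a b : Fin n} {p q : ℝ} (hq0 : 0 ≤ q)
    (hp : ∀ e, mean w (fun E => ind (e ∈ E)) ≤ p)
    (hq : ∀ e ∈ touching a b, mean w (fun E => ind (s(a, b) ∈ E ∧ e ∈ E)) ≤ q) :
    prodMean w m (overlap a b) ≤
      (m : ℝ) ^ 2 * p ^ 2 + (m : ℝ) ^ 2 * (2 * n) * (q * p + m * p ^ 3) := by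
  have hpos : ∀ e, 0 ≤ mean w (fun E => ind (e ∈ E)) := fun e =>
    mean_nonneg hw fun _ => ind_nonneg _
  have hp0 : 0 ≤ p := (hpos s(a, b)).trans (hp _)
  have hsum1 : ∀ (k : Fin m) (c : Fin m → ℝ) (x : ℝ), 0 ≤ x → (∀ l ∈ Finset.univ.erase k, c l ≤ x) →
      ∑ l ∈ Finset.univ.erase k, c l ≤ m * x := by
    intro k c x hx h
    refine (Finset.sum_le_card_nsmul _ _ _ h).trans ?_
    rw [nsmul_eq_mul]
    refine mul_le_mul_of_nonneg_right ?_ hx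
    have := Finset.card_le_univ (Finset.univ.erase k)
    rw [Fintype.card_fin] at this
    exact_mod_cast this
  have hsum2 : ∀ (c : Fin m → ℝ) (x : ℝ), (∀ k, c k ≤ x) → ∑ k, c k ≤ m * x := by
    intro c x h
    refine (Finset.sum_le_card_nsmul _ _ _ fun k _ => h k).trans ?_
    rw [nsmul_eq_mul, Finset.card_univ, Fintype.card_fin]
  unfold overlap
  rw [prodMean_add]
  refine add_le_add ?_ ?_
  · rw [prodMean_sum]
    simp only [prodMean_sum]
    calc _ ≤ (m : ℝ) * (m * (p * p)) := ?_
      _ = _ := by ring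
    refine hsum2 _ _ fun k => hsum1 k _ _ (by positivity) fun l hl => ?_
    rw [prodMean_two hw1 (Finset.ne_of_mem_erase hl).symm (fun e => ind (s(a, b) ∈ e))
      (fun e => ind (s(a, b) ∈ e))]
    exact mul_le_mul (hp _) (hp _) (hpos _) hp0
  · simp only [prodMean_sum, prodMean_add]
    calc _ ≤ (m : ℝ) * (m * (2 * n * (q * p + m * p ^ 3))) := ?_
      _ = _ := by ring
    refine hsum2 _ _ fun k => hsum1 k _ _ (by positivity) fun l hl => ?_
    have hlk := Finset.ne_of_mem_erase hl
    calc _ ≤ ((touching a b).card : ℝ) * (q * p + m * p ^ 3) := ?_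
      _ ≤ _ := mul_le_mul_of_nonneg_right (by exact_mod_cast card_touching_le a b)
        (by positivity)
    rw [← nsmul_eq_mul]
    refine Finset.sum_le_card_nsmul _ _ _ fun e he => add_le_add ?_ ?_
    · rw [prodMean_two hw1 hlk.symm (fun E => ind (s(a, b) ∈ E ∧ e ∈ E)) (fun E => ind (e ∈ E))]
      exact mul_le_mul (hq e he) (hp e) (hpos e) hq0
    · calc _ ≤ ∑ j ∈ (Finset.univ.erase k).erase l, p ^ 3 := ?_
        _ ≤ _ := ?_
      · refine Finset.sum_le_sum fun j hj => ?_
        have hjl := Finset.ne_of_mem_erase hj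
        have hjk := Finset.ne_of_mem_erase (Finset.mem_of_mem_erase hj)
        rw [prodMean_three hw1 hjk hjl hlk.symm (fun E => ind (s(a, b) ∈ E))
          (fun E => ind (e ∈ E)) (fun E => ind (e ∈ E)), pow_three, ← mul_assoc]
        exact mul_le_mul (mul_le_mul (hp _) (hp _) (hpos _) hp0) (hp _) (hpos _) (by positivity)
      · rw [Finset.sum_const, nsmul_eq_mul]
        refine mul_le_mul_of_nonneg_right ?_ (by positivity)
        have := Finset.card_le_univ ((Finset.univ.erase k).erase l)
        rw [Fintype.card_fin] at this
        exact_mod_cast this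

end Superposition

section Layer

instance (n : ℕ) : DiscreteMeasurableSpace (Finset (Fin n)) := ⟨fun _ => trivial⟩

theorem bern_real_singleton {y : ℝ} (hy : y ∈ Set.Icc (0 : ℝ) 1) (c : Bool) :
    (bern y).real {c} = if c then y else 1 - y := by
  have h1 : min (Real.toNNReal y) 1 = Real.toNNReal y :=
    min_eq_left (by rw [← Real.toNNReal_one]; exact Real.toNNReal_le_toNNReal hy.2)
  rw [bern, measureReal_def, PMF.toMeasure_apply_singleton _ _ (measurableSet_singleton c)]
  simp only [h1]
  cases c
  · simp [PMF.bernoulli, hy.1, hy.2]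
  · simp [PMF.bernoulli, hy.1]

/-- A pair that can carry an edge of a layer with node set `V`. -/
def Valid {n : ℕ} (V : Finset (Fin n)) (e : Sym2 (Fin n)) : Prop := ¬e.IsDiag ∧ ∀ v ∈ e, v ∈ V

/-- The edge set of a layer with node set `V` and edge indicators `f`. -/
def edgesOf {n : ℕ} (V : Finset (Fin n)) (f : Sym2 (Fin n) → Bool) : Finset (Sym2 (Fin n)) :=
  Finset.univ.filter fun e => f e = true ∧ ¬e.IsDiag ∧ ∀ v ∈ e, v ∈ V

theorem mem_edgesOf {n : ℕ} {V : Finset (Fin n)} {f : Sym2 (Fin n) → Bool} {e : Sym2 (Fin n)} :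
    e ∈ edgesOf V f ↔ f e = true ∧ Valid V e := by
  simp [edgesOf, Valid]

theorem sum_edgeMeasure_prod {n : ℕ} {R : Type*} [CommRing R] (c : ℝ →+* R) (V : Finset (Fin n))
    {y : ℝ} (hy : y ∈ Set.Icc (0 : ℝ) 1) (f1 f0 : Sym2 (Fin n) → R) :
    ∑ f, c ((edgeMeasure n V y).real {f}) * ∏ e, (if e ∈ edgesOf V f then f1 e else f0 e) =
      ∏ e, (if Valid V e then c (1 - y) * f0 e + c y * f1 e else f0 e) := by
  have hpi : ∀ f, (edgeMeasure n V y).real {f} = ∏ e, (edgeFactor n V y e).real {f e} := by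
    intro f
    simp only [edgeMeasure, measureReal_def, Measure.pi_singleton, ENNReal.toReal_prod]
  simp only [hpi, map_prod, ← Finset.prod_mul_distrib, mem_edgesOf]
  rw [← Fintype.piFinset_univ, ← Finset.prod_univ_sum (fun _ => Finset.univ)
    (fun e b => c ((edgeFactor n V y e).real {b}) * if b = true ∧ Valid V e then f1 e else f0 e)]
  refine Finset.prod_congr rfl fun e _ => ?_
  rw [Fintype.sum_bool]
  by_cases h : Valid V e
  · have hf : edgeFactor n V y e = bern y := if_pos h
    simp [hf, bern_real_singleton hy, h]
    ring
  · have hf : edgeFactor n V y e = Measure.dirac false := if_neg h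
    have ht : (Measure.dirac false).real {true} = 0 := by simp [measureReal_def]
    have hg : (Measure.dirac false).real {false} = 1 := by simp [measureReal_def]
    simp only [hf, h, ht, hg, and_false, if_false, map_zero, map_one]
    ring

/-- The mean of `Φ` of the edge set of a layer of type `(x, y)`. -/
def condMean (n : ℕ) (p : ℕ × ℝ) (Φ : Finset (Sym2 (Fin n)) → ℝ) : ℝ :=
  ∑ V, (vertexMeasure n p.1).real {V} * ∑ f, (edgeMeasure n V p.2).real {f} * Φ (edgesOf V f)

theorem vertexMeasure_real_singleton {n x : ℕ} (hx : x ≤ n) (V : Finset (Fin n)) :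
    (vertexMeasure n x).real {V} = if V.card = x then ((n.choose x : ℕ) : ℝ)⁻¹ else 0 := by
  have h : (Finset.powersetCard x (Finset.univ : Finset (Fin n))).Nonempty :=
    Finset.powersetCard_nonempty.2 (by simpa using hx)
  rw [vertexMeasure, dif_pos h, measureReal_def,
    PMF.toMeasure_apply_singleton _ _ (measurableSet_singleton V), PMF.uniformOfFinset_apply]
  simp only [Finset.mem_powersetCard, Finset.subset_univ, true_and, Finset.card_powersetCard,
    Finset.card_univ, Fintype.card_fin]
  split_ifs <;> simp

theorem choose_sub_mul_descFactorial {n x k : ℕ} (hk : k ≤ x) :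
    (n - k).choose (x - k) * n.descFactorial k = n.choose x * x.descFactorial k := by
  rw [Nat.descFactorial_eq_factorial_mul_choose, Nat.descFactorial_eq_factorial_mul_choose]
  have := Nat.choose_mul (n := n) hk
  calc _ = k.factorial * (n.choose k * (n - k).choose (x - k)) := by ring
    _ = _ := by rw [← this]; ring

theorem sum_vertexMeasure_subset {n x : ℕ} (hx : x ≤ n) (T : Finset (Fin n)) :
    ∑ V, (vertexMeasure n x).real {V} * ind (T ⊆ V) =
      (x.descFactorial T.card : ℝ) / n.descFactorial T.card := by
  have hT : T.card ≤ n := by simpa using Finset.card_le_univ T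
  have hn : (n.descFactorial T.card : ℝ) ≠ 0 := by
    have := Nat.descFactorial_eq_zero_iff_lt.not.2 (not_lt.2 hT)
    exact_mod_cast this
  have hc : ((n.choose x : ℕ) : ℝ) ≠ 0 := by
    exact_mod_cast (Nat.choose_pos hx).ne'
  have hsum : ∑ V, (vertexMeasure n x).real {V} * ind (T ⊆ V) =
      ((n.choose x : ℕ) : ℝ)⁻¹ *
        (((Finset.univ : Finset (Fin n)).powersetCard x).filter (T ⊆ ·)).card := by
    rw [Finset.card_filter, Nat.cast_sum, Finset.mul_sum, Finset.powersetCard_eq_filter,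
      Finset.sum_filter, Finset.powerset_univ]
    refine Finset.sum_congr rfl fun V _ => ?_
    rw [vertexMeasure_real_singleton hx]
    by_cases h1 : V.card = x <;> by_cases h2 : T ⊆ V <;> simp [h1, h2, ind]
  rw [hsum]
  by_cases hk : T.card ≤ x
  · rw [Finset.card_filter_powersetCard_subset T _ _ (Finset.subset_univ _) hk, Finset.card_univ,
      Fintype.card_fin, inv_mul_eq_div, div_eq_div_iff hc hn]
    have := choose_sub_mul_descFactorial (n := n) hk
    rw [mul_comm (x.descFactorial T.card : ℝ)]
    exact_mod_cast this
  · rw [Nat.descFactorial_eq_zero_iff_lt.2 (not_le.1 hk), Finset.filter_eq_empty_iff.2]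
    · simp
    · intro V hV h
      have := Finset.card_le_card h
      rw [(Finset.mem_powersetCard.1 hV).2] at this
      exact hk this

theorem sum_vertexMeasure {n x : ℕ} : ∑ V, (vertexMeasure n x).real {V} = 1 := by
  rw [sum_measureReal_singleton]
  simp

theorem sum_edgeMeasure {n : ℕ} (V : Finset (Fin n)) (y : ℝ) :
    ∑ f, (edgeMeasure n V y).real {f} = 1 := by
  rw [sum_measureReal_singleton]
  simp

theorem condMean_nonneg {n : ℕ} (p : ℕ × ℝ) {Φ : Finset (Sym2 (Fin n)) → ℝ} (h : ∀ E, 0 ≤ Φ E) :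
    0 ≤ condMean n p Φ :=
  Finset.sum_nonneg fun _ _ => mul_nonneg measureReal_nonneg
    (Finset.sum_nonneg fun _ _ => mul_nonneg measureReal_nonneg (h _))

theorem condMean_one (n : ℕ) (p : ℕ × ℝ) : condMean n p (fun _ => 1) = 1 := by
  simp only [condMean, mul_one, sum_edgeMeasure, sum_vertexMeasure]

theorem condMean_subset {n : ℕ} {p : ℕ × ℝ} (hy : p.2 ∈ Set.Icc (0 : ℝ) 1)
    (S : Finset (Sym2 (Fin n))) :
    condMean n p (fun E => ind (S ⊆ E)) =
      ∑ V, (vertexMeasure n p.1).real {V} * (p.2 ^ S.card * ind (∀ e ∈ S, Valid V e)) := by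
  refine Finset.sum_congr rfl fun V _ => ?_
  congr 1
  have h := sum_edgeMeasure_prod (RingHom.id ℝ) V hy (fun _ => 1) (fun e => if e ∈ S then 0 else 1)
  have hl : ∀ E : Finset (Sym2 (Fin n)),
      ∏ e, (if e ∈ E then (1 : ℝ) else if e ∈ S then 0 else 1) = ind (S ⊆ E) := by
    intro E
    by_cases hS : S ⊆ E
    · rw [ind_true hS]
      refine Finset.prod_eq_one fun e _ => ?_
      by_cases he : e ∈ E
      · simp [he]
      · have : e ∉ S := fun h => he (hS h)
        simp [he, this]
    · rw [ind_false hS]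
      obtain ⟨e, heS, heE⟩ := Finset.not_subset.1 hS
      exact Finset.prod_eq_zero (Finset.mem_univ e) (by simp [heS, heE])
  simp only [hl, RingHom.id_apply] at h
  rw [h]
  have hr : ∀ e, (if Valid V e then (1 - p.2) * (if e ∈ S then 0 else 1) + p.2 * 1
      else if e ∈ S then (0 : ℝ) else 1) =
      if e ∈ S then (if Valid V e then p.2 else 0) else 1 := by
    intro e
    by_cases h1 : Valid V e <;> by_cases h2 : e ∈ S <;> simp [h1, h2]
  simp only [hr]
  rw [Finset.prod_ite_mem, Finset.univ_inter]
  by_cases hS : ∀ e ∈ S, Valid V e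
  · rw [ind_true hS, mul_one, Finset.prod_congr rfl fun e he => if_pos (hS e he),
      Finset.prod_const]
  · rw [ind_false hS, mul_zero]
    push Not at hS
    obtain ⟨e, he, hv⟩ := hS
    exact Finset.prod_eq_zero he (if_neg hv)

theorem condMean_subset_le {n : ℕ} {p : ℕ × ℝ} (hx : p.1 ≤ n) (hy : p.2 ∈ Set.Icc (0 : ℝ) 1)
    (S : Finset (Sym2 (Fin n))) (k : ℕ)
    (hT : (∀ V, ¬∀ e ∈ S, Valid V e) ∨
      ∃ T : Finset (Fin n), T.card = k ∧ ∀ V, (∀ e ∈ S, Valid V e) → T ⊆ V) :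
    condMean n p (fun E => ind (S ⊆ E)) ≤
      (p.1.descFactorial k : ℝ) / n.descFactorial k * p.2 ^ S.card := by
  have hy0 : 0 ≤ p.2 := hy.1
  rw [condMean_subset hy]
  rcases hT with h | ⟨T, rfl, hT⟩
  · rw [Finset.sum_eq_zero fun V _ => by rw [ind_false (h V), mul_zero, mul_zero]]
    positivity
  · rw [← sum_vertexMeasure_subset hx, Finset.sum_mul]
    refine Finset.sum_le_sum fun V _ => ?_
    rw [mul_assoc]
    refine mul_le_mul_of_nonneg_left ?_ measureReal_nonneg
    rw [mul_comm]
    refine mul_le_mul_of_nonneg_right ?_ (by positivity)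
    by_cases h : ∀ e ∈ S, Valid V e
    · rw [ind_true h, ind_true (hT V h)]
    · rw [ind_false h]
      exact ind_nonneg _

theorem condMean_mem_le {n : ℕ} {p : ℕ × ℝ} (hx : p.1 ≤ n) (hy : p.2 ∈ Set.Icc (0 : ℝ) 1)
    (e : Sym2 (Fin n)) :
    condMean n p (fun E => ind (e ∈ E)) ≤
      (p.1.descFactorial 2 : ℝ) / n.descFactorial 2 * p.2 := by
  have h := condMean_subset_le hx hy {e} 2 (by
    induction e with
    | h u v =>
      by_cases huv : u = v
      · subst huv
        exact Or.inl fun V h => (h _ (Finset.mem_singleton_self _)).1 (by simp)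
      · refine Or.inr ⟨{u, v}, Finset.card_pair huv, fun V h => ?_⟩
        have := (h _ (Finset.mem_singleton_self _)).2
        intro z hz
        exact this z (by simpa using hz))
  simpa using h

theorem condMean_mem_mem_le {n : ℕ} {p : ℕ × ℝ} (hx : p.1 ≤ n) (hy : p.2 ∈ Set.Icc (0 : ℝ) 1)
    {a b : Fin n} (hab : a ≠ b) {e : Sym2 (Fin n)} (he : e ∈ touching a b) :
    condMean n p (fun E => ind (s(a, b) ∈ E ∧ e ∈ E)) ≤
      (p.1.descFactorial 3 : ℝ) / n.descFactorial 3 * p.2 ^ 2 := by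
  obtain ⟨hne, ht⟩ := (Finset.mem_filter.1 he).2
  have h := condMean_subset_le hx hy {s(a, b), e} 3 (by
    by_cases hd : e.IsDiag
    · exact Or.inl fun V h => (h e (by simp)).1 hd
    · obtain ⟨v, hav, hbv, hv⟩ : ∃ v, v ≠ a ∧ v ≠ b ∧ v ∈ e := by
        rcases ht with h | h
        · obtain ⟨v, rfl⟩ := Sym2.mem_iff_exists.1 h
          refine ⟨v, ?_, ?_, by simp⟩
          · rintro rfl; exact hd (by simp)
          · rintro rfl; exact hne rfl
        · obtain ⟨v, rfl⟩ := Sym2.mem_iff_exists.1 h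
          refine ⟨v, ?_, ?_, by simp⟩
          · rintro rfl; exact hne Sym2.eq_swap
          · rintro rfl; exact hd (by simp)
      refine Or.inr ⟨{a, b, v}, Finset.card_eq_three.2 ⟨a, b, v, hab, hav.symm, hbv.symm, rfl⟩,
        fun V h => ?_⟩
      have h1 := (h s(a, b) (by simp)).2
      have h2 := (h e (by simp)).2
      intro z hz
      simp only [Finset.mem_insert, Finset.mem_singleton] at hz
      rcases hz with rfl | rfl | rfl
      · exact h1 _ (by simp)
      · exact h1 _ (by simp)
      · exact h2 _ hv)
  rw [Finset.card_pair (Ne.symm hne)] at h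
  refine le_trans (le_of_eq ?_) h
  congr 1
  funext E
  congr 1
  simp [Finset.insert_subset_iff]

end Layer

section GenFun

theorem coeff_bernoulliSeries_pow (y : ℝ) (k : ℕ) :
    (PowerSeries.C (1 - y) + PowerSeries.C y * PowerSeries.X) ^ k = PowerSeries.mk (binP k y) := by
  ext s
  rw [add_comm, add_pow, PowerSeries.coeff_mk, map_sum, binP]
  have h : ∀ i ∈ Finset.range (k + 1), PowerSeries.coeff s
      ((PowerSeries.C y * PowerSeries.X) ^ i * PowerSeries.C (1 - y) ^ (k - i) *
        (k.choose i : PowerSeries ℝ)) =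
      if s = i then (k.choose i : ℝ) * y ^ i * (1 - y) ^ (k - i) else 0 := by
    intro i _
    have : (PowerSeries.C y * PowerSeries.X) ^ i * PowerSeries.C (1 - y) ^ (k - i) *
        (k.choose i : PowerSeries ℝ) =
        PowerSeries.C ((k.choose i : ℝ) * y ^ i * (1 - y) ^ (k - i)) * PowerSeries.X ^ i := by
      simp only [map_mul, map_pow, map_natCast, mul_pow]
      ring
    rw [this, PowerSeries.coeff_C_mul, PowerSeries.coeff_X_pow]
    split_ifs <;> simp
  rw [Finset.sum_congr rfl h, Finset.sum_ite_eq]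
  split_ifs with hs
  · rfl
  · rw [Nat.choose_eq_zero_of_lt (by simpa using hs)]
    simp

theorem inX_bernoulliSeries (y : ℝ) :
    inX (PowerSeries.C (1 - y) + PowerSeries.C y * PowerSeries.X) =
      scalar (1 - y) * 1 + scalar y * monom 1 0 := by
  simp [monom, inX, inY, scalar]

theorem inY_bernoulliSeries (y : ℝ) :
    inY (PowerSeries.C (1 - y) + PowerSeries.C y * PowerSeries.X) =
      scalar (1 - y) * 1 + scalar y * monom 0 1 := by
  simp [monom, inX, inY, scalar]

variable {n : ℕ}

theorem prod_sym2_touching {R : Type*} [CommRing R] {a b : Fin n} (hab : a ≠ b)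
    (F : Sym2 (Fin n) → R) (hF : ∀ e, a ∉ e → b ∉ e → F e = 1) (ha : F s(a, a) = 1)
    (hb : F s(b, b) = 1) :
    ∏ e, F e = F s(a, b) * ((∏ v ∈ ({a, b} : Finset (Fin n))ᶜ, F s(a, v)) *
      ∏ v ∈ ({a, b} : Finset (Fin n))ᶜ, F s(b, v)) := by
  set T : Finset (Fin n) := ({a, b} : Finset (Fin n))ᶜ with hT
  have hTa : ∀ v ∈ T, v ≠ a ∧ v ≠ b := by
    intro v hv
    simpa [hT] using hv
  have hinj : ∀ c : Fin n, Set.InjOn (fun v => s(c, v)) (T : Set (Fin n)) := by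
    intro c v _ v' _ h
    exact Sym2.congr_right.1 h
  rw [← Finset.prod_image (f := F) (hinj a), ← Finset.prod_image (f := F) (hinj b),
    ← Finset.prod_union, ← Finset.prod_insert]
  · refine (Finset.prod_subset (Finset.subset_univ _) fun e _ he => ?_).symm
    by_cases h1 : a ∈ e
    · obtain ⟨v, rfl⟩ := Sym2.mem_iff_exists.1 h1
      by_cases hva : v = a
      · rw [hva, ha]
      by_cases hvb : v = b
      · exact absurd (by simp [hvb]) he
      · refine absurd ?_ he
        refine Finset.mem_insert_of_mem (Finset.mem_union_left _ (Finset.mem_image_of_mem _ ?_))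
        simp [hT, hva, hvb]
    by_cases h2 : b ∈ e
    · obtain ⟨v, rfl⟩ := Sym2.mem_iff_exists.1 h2
      by_cases hvb : v = b
      · rw [hvb, hb]
      by_cases hva : v = a
      · exact absurd (by simp [hva]) h1
      · refine absurd ?_ he
        refine Finset.mem_insert_of_mem (Finset.mem_union_right _ (Finset.mem_image_of_mem _ ?_))
        simp [hT, hva, hvb]
    exact hF e h1 h2
  · intro h
    rcases Finset.mem_union.1 h with h | h
    · obtain ⟨v, hv, h⟩ := Finset.mem_image.1 h
      have := hTa v hv
      exact this.2 (Sym2.congr_right.1 h)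
    · obtain ⟨v, hv, h⟩ := Finset.mem_image.1 h
      have := hTa v hv
      rw [Sym2.eq_swap] at h
      exact this.1 (Sym2.congr_left.1 h)
  · rw [Finset.disjoint_left]
    intro e h1 h2
    obtain ⟨v, hv, rfl⟩ := Finset.mem_image.1 h1
    obtain ⟨v', hv', h⟩ := Finset.mem_image.1 h2
    have h3 := hTa v hv
    have h4 := hTa v' hv'
    have h5 : a ∈ s(b, v') := by rw [h]; simp
    rcases Sym2.mem_iff.1 h5 with h5 | h5
    · exact hab h5
    · exact h4.1 h5.symm

/-- The degree monomial of an edge set, weighted by `θ` if `{a, b}` is not an edge. -/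
def degMonom (a b : Fin n) (θ : BiSeries) (E : Finset (Sym2 (Fin n))) : BiSeries :=
  (if s(a, b) ∈ E then 1 else θ) * monom (edgeDeg a E) (edgeDeg b E)

theorem degMonom_eq_prod (a b : Fin n) (θ : BiSeries) (E : Finset (Sym2 (Fin n))) :
    degMonom a b θ E = ∏ e, if e ∈ E then monom (if a ∈ e then 1 else 0) (if b ∈ e then 1 else 0)
      else if e = s(a, b) then θ else 1 := by
  have h : ∀ e : Sym2 (Fin n), (if e ∈ E then
      monom (if a ∈ e then 1 else 0) (if b ∈ e then 1 else 0)
      else if e = s(a, b) then θ else 1) =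
      (if e = s(a, b) then (if s(a, b) ∈ E then 1 else θ) else 1) *
        if e ∈ E then monom (if a ∈ e then 1 else 0) (if b ∈ e then 1 else 0) else 1 := by
    intro e
    by_cases h1 : e = s(a, b)
    · subst h1
      by_cases h2 : s(a, b) ∈ E <;> simp [h2]
    · by_cases h2 : e ∈ E <;> simp [h1, h2]
  simp only [h, Finset.prod_mul_distrib]
  rw [Finset.prod_ite_eq' Finset.univ, if_pos (Finset.mem_univ _), Finset.prod_ite_mem,
    Finset.univ_inter, prod_monom, degMonom]
  simp only [edgeDeg, Finset.card_filter]

theorem monom_zero_zero : monom 0 0 = 1 := by simp [monom]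

theorem scalar_add_scalar (y : ℝ) : scalar (1 - y) + scalar y = 1 := by
  rw [← map_add]; simp

theorem card_sdiff_pair {a b : Fin n} (V : Finset (Fin n)) :
    (({a, b} : Finset (Fin n))ᶜ ∩ V).card = V.card - (V ∩ {a, b}).card := by
  rw [Finset.inter_comm, ← Finset.sdiff_eq_inter_compl, Finset.card_sdiff, Finset.inter_comm]

theorem prod_star (a b : Fin n) (V : Finset (Fin n)) {c : Fin n} (A : BiSeries) :
    ∏ v ∈ ({a, b} : Finset (Fin n))ᶜ, (if c ∈ V ∧ v ∈ V then A else 1) =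
      if c ∈ V then A ^ (V.card - (V ∩ {a, b}).card) else 1 := by
  by_cases hc : c ∈ V
  · simp only [hc, true_and, if_true]
    rw [Finset.prod_ite_mem, Finset.prod_const, card_sdiff_pair]
  · simp [hc]

theorem sum_edgeMeasure_degMonom {a b : Fin n} (hab : a ≠ b) (V : Finset (Fin n)) {y : ℝ}
    (hy : y ∈ Set.Icc (0 : ℝ) 1) (θ : BiSeries) :
    ∑ f, scalar ((edgeMeasure n V y).real {f}) * degMonom a b θ (edgesOf V f) =
      (if a ∈ V ∧ b ∈ V then scalar (1 - y) * θ + scalar y * monom 1 1 else θ) *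
      ((if a ∈ V then inX (PowerSeries.mk (binP (V.card - (V ∩ {a, b}).card) y)) else 1) *
        if b ∈ V then inY (PowerSeries.mk (binP (V.card - (V ∩ {a, b}).card) y)) else 1) := by
  simp only [degMonom_eq_prod]
  rw [sum_edgeMeasure_prod scalar V hy, prod_sym2_touching hab]
  · congr 1
    · simp [Valid, hab]
    congr 1
    · rw [← coeff_bernoulliSeries_pow, map_pow, ← prod_star]
      refine Finset.prod_congr rfl fun v hv => ?_
      have hv' : v ≠ a ∧ v ≠ b := by simpa using hv
      have h1 : Valid V s(a, v) ↔ a ∈ V ∧ v ∈ V := by simp [Valid, hv'.1.symm]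
      rw [inX_bernoulliSeries]
      simp [h1, hv'.1, hv'.2, hv'.2.symm, hab, hab.symm]
    · rw [← coeff_bernoulliSeries_pow, map_pow, ← prod_star]
      refine Finset.prod_congr rfl fun v hv => ?_
      have hv' : v ≠ a ∧ v ≠ b := by simpa using hv
      have h1 : Valid V s(b, v) ↔ b ∈ V ∧ v ∈ V := by simp [Valid, hv'.2.symm]
      rw [inY_bernoulliSeries]
      simp [h1, hv'.1, hv'.2, hv'.1.symm, hab, hab.symm]
  · intro e h1 h2
    have h3 : e ≠ s(a, b) := by rintro rfl; simp at h1
    simp only [h1, h2, h3, if_false, monom_zero_zero, mul_one, scalar_add_scalar, ite_self]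
  · simp [Valid, hab]
  · simp [Valid, hab.symm]

theorem condMean_bicoeff (p : ℕ × ℝ) (M : Finset (Sym2 (Fin n)) → BiSeries) (s t : ℕ) :
    condMean n p (fun E => bicoeff s t (M E)) =
      bicoeff s t (∑ V, scalar ((vertexMeasure n p.1).real {V}) *
        ∑ f, scalar ((edgeMeasure n V p.2).real {f}) * M (edgesOf V f)) := by
  simp only [condMean, map_sum, bicoeff_scalar_mul]

/-- Binomial generating series in two independent variables. -/
def binXY (k : ℕ) (y : ℝ) : BiSeries :=
  inX (PowerSeries.mk (binP k y)) * inY (PowerSeries.mk (binP k y))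

/-- Correction to the degree generating series when both nodes belong to the layer. -/
def pairTerm (x : ℕ) (y : ℝ) : BiSeries :=
  (scalar (1 - y) + scalar y * monom 1 1) * binXY (x - 2) y -
    inX (PowerSeries.mk (binP (x - 1) y)) - inY (PowerSeries.mk (binP (x - 1) y)) + 1

theorem sum_scalar_vertexMeasure {x : ℕ} (hx : x ≤ n) (T : Finset (Fin n)) :
    ∑ V, scalar ((vertexMeasure n x).real {V}) * scalar (ind (T ⊆ V)) =
      scalar ((x.descFactorial T.card : ℝ) / n.descFactorial T.card) := by
  rw [← sum_vertexMeasure_subset hx, map_sum]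
  simp only [map_mul]

theorem scalar_vertexMeasure_congr {x : ℕ} (hx : x ≤ n) (V : Finset (Fin n)) {F G : BiSeries}
    (h : V.card = x → F = G) :
    scalar ((vertexMeasure n x).real {V}) * F = scalar ((vertexMeasure n x).real {V}) * G := by
  by_cases hV : V.card = x
  · rw [h hV]
  · rw [vertexMeasure_real_singleton hx, if_neg hV]
    simp

theorem condMean_adj_deg {a b : Fin n} (hab : a ≠ b) {p : ℕ × ℝ} (hx : p.1 ≤ n)
    (hy : p.2 ∈ Set.Icc (0 : ℝ) 1) (s t : ℕ) :
    condMean n p (fun E => ind (s(a, b) ∈ E) * ind (edgeDeg a E = s ∧ edgeDeg b E = t)) =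
      (p.1.descFactorial 2 : ℝ) / n.descFactorial 2 * p.2 *
        bicoeff s t (monom 1 1 * binXY (p.1 - 2) p.2) := by
  have h0 : (fun E => ind (s(a, b) ∈ E) * ind (edgeDeg a E = s ∧ edgeDeg b E = t)) =
      fun E => bicoeff s t (degMonom a b 0 E) := by
    funext E
    by_cases h : s(a, b) ∈ E
    · simp [degMonom, h, bicoeff_monom, ind_true]
    · simp [degMonom, h, ind_false]
  rw [h0, condMean_bicoeff]
  have hV : ∀ V : Finset (Fin n), scalar ((vertexMeasure n p.1).real {V}) *
        ∑ f, scalar ((edgeMeasure n V p.2).real {f}) * degMonom a b 0 (edgesOf V f) =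
      scalar ((vertexMeasure n p.1).real {V}) * scalar (ind ({a, b} ⊆ V)) *
        (scalar p.2 * (monom 1 1 * binXY (p.1 - 2) p.2)) := by
    intro V
    rw [mul_assoc]
    refine scalar_vertexMeasure_congr hx V fun hc => ?_
    rw [sum_edgeMeasure_degMonom hab V hy, hc]
    by_cases h : a ∈ V ∧ b ∈ V
    · have hs : ({a, b} : Finset (Fin n)) ⊆ V := by
        intro z; simp only [Finset.mem_insert, Finset.mem_singleton]; rintro (rfl | rfl)
        exacts [h.1, h.2]
      rw [Finset.inter_eq_right.2 hs, Finset.card_pair hab, ind_true hs]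
      simp only [h.1, h.2, binXY, and_self, if_true, map_one]
      ring
    · have hs : ¬({a, b} : Finset (Fin n)) ⊆ V := fun hs => h ⟨hs (by simp), hs (by simp)⟩
      simp [h, ind_false hs]
  simp only [hV]
  rw [← Finset.sum_mul, sum_scalar_vertexMeasure hx, Finset.card_pair hab, bicoeff_scalar_mul,
    bicoeff_scalar_mul, mul_assoc]

theorem condMean_deg {a b : Fin n} (hab : a ≠ b) {p : ℕ × ℝ} (hx : p.1 ≤ n)
    (hy : p.2 ∈ Set.Icc (0 : ℝ) 1) (s t : ℕ) :
    condMean n p (fun E => ind (edgeDeg a E = s ∧ edgeDeg b E = t)) =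
      bicoeff s t 1 + (p.1 : ℝ) / n *
          bicoeff s t (inX (PowerSeries.mk (binP (p.1 - 1) p.2)) - 1) +
        (p.1 : ℝ) / n * bicoeff s t (inY (PowerSeries.mk (binP (p.1 - 1) p.2)) - 1) +
        (p.1.descFactorial 2 : ℝ) / n.descFactorial 2 * bicoeff s t (pairTerm p.1 p.2) := by
  have h0 : (fun E => ind (edgeDeg a E = s ∧ edgeDeg b E = t)) =
      fun E => bicoeff s t (degMonom a b 1 E) := by
    funext E
    simp [degMonom, bicoeff_monom]
  rw [h0, condMean_bicoeff]
  have hV : ∀ V : Finset (Fin n), scalar ((vertexMeasure n p.1).real {V}) *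
        ∑ f, scalar ((edgeMeasure n V p.2).real {f}) * degMonom a b 1 (edgesOf V f) =
      scalar ((vertexMeasure n p.1).real {V}) * scalar (ind (∅ ⊆ V)) * 1 +
      scalar ((vertexMeasure n p.1).real {V}) * scalar (ind ({a} ⊆ V)) *
        (inX (PowerSeries.mk (binP (p.1 - 1) p.2)) - 1) +
      scalar ((vertexMeasure n p.1).real {V}) * scalar (ind ({b} ⊆ V)) *
        (inY (PowerSeries.mk (binP (p.1 - 1) p.2)) - 1) +
      scalar ((vertexMeasure n p.1).real {V}) * scalar (ind ({a, b} ⊆ V)) *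
        pairTerm p.1 p.2 := by
    intro V
    simp only [mul_assoc, ← mul_add]
    refine scalar_vertexMeasure_congr hx V fun hc => ?_
    rw [sum_edgeMeasure_degMonom hab V hy, hc]
    have h1 : ({a, b} : Finset (Fin n)) ⊆ V ↔ a ∈ V ∧ b ∈ V := by simp [Finset.insert_subset_iff]
    rw [h1]
    simp only [Finset.singleton_subset_iff, ind_true (Finset.empty_subset V)]
    by_cases ha : a ∈ V <;> by_cases hb : b ∈ V
    · have hs : V ∩ {a, b} = {a, b} := Finset.inter_eq_right.2 (h1.2 ⟨ha, hb⟩)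
      simp only [ha, hb, hs, Finset.card_pair hab, and_self, if_true, ind_true, map_one, pairTerm,
        binXY]
      ring
    · have hs : V ∩ {a, b} = {a} := by
        ext z; simp only [Finset.mem_inter, Finset.mem_insert, Finset.mem_singleton]
        constructor
        · rintro ⟨hz, rfl | rfl⟩
          exacts [rfl, absurd hz hb]
        · rintro rfl; exact ⟨ha, Or.inl rfl⟩
      simp [ha, hb, hs, ind]
    · have hs : V ∩ {a, b} = {b} := by
        ext z; simp only [Finset.mem_inter, Finset.mem_insert, Finset.mem_singleton]
        constructor
        · rintro ⟨hz, rfl | rfl⟩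
          exacts [absurd hz ha, rfl]
        · rintro rfl; exact ⟨hb, Or.inr rfl⟩
      simp [ha, hb, hs, ind]
    · simp [ha, hb, ind]
  simp only [hV]
  simp only [Finset.sum_add_distrib, ← Finset.sum_mul, sum_scalar_vertexMeasure hx, map_add,
    bicoeff_scalar_mul, Finset.card_pair hab, Finset.card_singleton, Finset.card_empty,
    Nat.descFactorial_one, Nat.descFactorial_zero]
  simp

theorem binP_nonneg {y : ℝ} (hy : y ∈ Set.Icc (0 : ℝ) 1) (k s : ℕ) : 0 ≤ binP k y s := by
  have h1 := hy.1
  have h2 := sub_nonneg.2 hy.2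
  unfold binP
  positivity

theorem binP_le_one {y : ℝ} (hy : y ∈ Set.Icc (0 : ℝ) 1) (k s : ℕ) : binP k y s ≤ 1 := by
  have h1 := hy.1
  have h2 := sub_nonneg.2 hy.2
  by_cases hs : s ≤ k
  · have h := add_pow y (1 - y) k
    rw [add_sub_cancel, one_pow] at h
    rw [h, binP]
    have := Finset.single_le_sum (f := fun i => y ^ i * (1 - y) ^ (k - i) * (k.choose i : ℝ))
      (fun i _ => by positivity) (Finset.mem_range_succ_iff.2 hs)
    refine le_trans (le_of_eq ?_) this
    ring
  · rw [binP, Nat.choose_eq_zero_of_lt (not_le.1 hs)]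
    simp

theorem bicoeff_binXY (k : ℕ) (y : ℝ) (s t : ℕ) :
    bicoeff s t (binXY k y) = binP k y s * binP k y t := by
  simp [binXY, bicoeff_inX_mul_inY]

theorem abs_bicoeff_inX_le {y : ℝ} (hy : y ∈ Set.Icc (0 : ℝ) 1) (k s t : ℕ) :
    |bicoeff s t (inX (PowerSeries.mk (binP k y)))| ≤ 1 := by
  rw [bicoeff_inX]
  have h1 := binP_nonneg hy k s
  have h2 := binP_le_one hy k s
  simp only [PowerSeries.coeff_mk]
  split_ifs
  · rw [mul_one, abs_of_nonneg h1]; exact h2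
  · simp

theorem abs_bicoeff_inY_le {y : ℝ} (hy : y ∈ Set.Icc (0 : ℝ) 1) (k s t : ℕ) :
    |bicoeff s t (inY (PowerSeries.mk (binP k y)))| ≤ 1 := by
  rw [bicoeff_inY]
  have h1 := binP_nonneg hy k t
  have h2 := binP_le_one hy k t
  simp only [PowerSeries.coeff_mk]
  split_ifs
  · rw [one_mul, abs_of_nonneg h1]; exact h2
  · simp

theorem abs_bicoeff_one_le (s t : ℕ) : |bicoeff s t 1| ≤ 1 := by
  rw [bicoeff_one]
  split_ifs <;> simp

theorem abs_bicoeff_mul_le {F G : BiSeries} (hF : ∀ s t, |bicoeff s t F| ≤ 1)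
    (hG : ∀ s t, |bicoeff s t G| ≤ 1) (s t : ℕ) :
    |bicoeff s t (F * G)| ≤ (s + 1) * (t + 1) := by
  rw [bicoeff_mul]
  have h1 : ∀ i j : ℕ × ℕ, |bicoeff i.1 j.1 F * bicoeff i.2 j.2 G| ≤ 1 := fun i j => by
    rw [abs_mul]
    exact mul_le_one₀ (hF _ _) (abs_nonneg _) (hG _ _)
  calc _ ≤ ∑ i ∈ Finset.HasAntidiagonal.antidiagonal s,
        ∑ j ∈ Finset.HasAntidiagonal.antidiagonal t, (1 : ℝ) :=
        (Finset.abs_sum_le_sum_abs _ _).trans (Finset.sum_le_sum fun i _ =>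
          (Finset.abs_sum_le_sum_abs _ _).trans (Finset.sum_le_sum fun j _ => h1 i j))
    _ = _ := by simp; ring

theorem abs_bicoeff_pairTerm_le {y : ℝ} (hy : y ∈ Set.Icc (0 : ℝ) 1) (x s t : ℕ) :
    |bicoeff s t (pairTerm x y)| ≤ (s + 1) * (t + 1) + 3 := by
  have h1 := abs_bicoeff_mul_le (F := scalar (1 - y) + scalar y * monom 1 1)
    (G := binXY (x - 2) y) (fun s t => by
      have hi0 := ind_nonneg (1 = s ∧ 1 = t)
      have hi1 := ind_le_one (1 = s ∧ 1 = t)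
      have h := hy.1
      have h' := hy.2
      have := bicoeff_scalar s t (1 - y)
      rw [map_add, bicoeff_scalar_mul, bicoeff_monom, this, abs_le]
      split_ifs <;> constructor <;> nlinarith) (fun s t => by
      rw [bicoeff_binXY, abs_of_nonneg (mul_nonneg (binP_nonneg hy _ _) (binP_nonneg hy _ _))]
      exact mul_le_one₀ (binP_le_one hy _ _) (binP_nonneg hy _ _) (binP_le_one hy _ _)) s t
  have h2 := abs_bicoeff_inX_le hy (x - 1) s t
  have h3 := abs_bicoeff_inY_le hy (x - 1) s t
  have h4 := abs_bicoeff_one_le s t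
  rw [pairTerm, map_add, map_sub, map_sub]
  rw [abs_le] at *
  constructor <;> linarith [h1.1, h1.2, h2.1, h2.2, h3.1, h3.2, h4.1, h4.2]

end GenFun

section Law

variable {n : ℕ}

theorem measurable_bern_singleton (c : Bool) : Measurable fun y : ℝ => bern y {c} := by
  have h : ∀ y, bern y {c} = if c then ((min (Real.toNNReal y) 1 : NNReal) : ℝ≥0∞)
      else ((1 - min (Real.toNNReal y) 1 : NNReal) : ℝ≥0∞) := by
    intro y
    rw [bern, PMF.toMeasure_apply_singleton _ _ (measurableSet_singleton c)]
    cases c <;> simp [PMF.bernoulli]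
  simp only [h]
  cases c <;> simp only [if_true, Bool.false_eq_true, if_false] <;> fun_prop

theorem measurable_edgeMeasure_singleton (V : Finset (Fin n)) (f : Sym2 (Fin n) → Bool) :
    Measurable fun y : ℝ => edgeMeasure n V y {f} := by
  simp only [edgeMeasure, Measure.pi_singleton]
  refine Finset.measurable_prod _ fun e _ => ?_
  by_cases h : Valid V e
  · have : ∀ y, edgeFactor n V y e = bern y := fun y => if_pos h
    simp only [this]
    exact measurable_bern_singleton _
  · have : ∀ y, edgeFactor n V y e = Measure.dirac false := fun y => if_neg h
    simp only [this]
    exact measurable_const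

theorem measurable_vertexMeasure_singleton (V : Finset (Fin n)) :
    Measurable fun p : ℕ × ℝ => vertexMeasure n p.1 {V} :=
  (Measurable.of_discrete (f := fun x : ℕ => vertexMeasure n x {V})).comp measurable_fst

theorem measurable_condMean (Φ : Finset (Sym2 (Fin n)) → ℝ) :
    Measurable fun p => condMean n p Φ := by
  unfold condMean
  refine Finset.measurable_sum _ fun V _ => ?_
  refine ((measurable_vertexMeasure_singleton V).ennreal_toReal).mul ?_
  refine Finset.measurable_sum _ fun f _ => ?_
  exact (((measurable_edgeMeasure_singleton V f).comp measurable_snd).ennreal_toReal).mul_const _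

/-- The law of the node set and edge indicators of a layer of type `p`, as a layer law. -/
def typedLayer (n : ℕ) (p : ℕ × ℝ) : Measure (Layer n) :=
  (vertexMeasure n p.1).bind fun V => (edgeMeasure n V p.2).map fun f => (p, V, f)

theorem typedLayer_apply (p : ℕ × ℝ) {S : Set (Layer n)} (hS : MeasurableSet S) :
    typedLayer n p S = ∑ V, vertexMeasure n p.1 {V} *
      ∑ f, edgeMeasure n V p.2 {f} * S.indicator 1 (p, V, f) := by
  have hm : ∀ V : Finset (Fin n),
      Measurable fun f : Sym2 (Fin n) → Bool => ((p, V, f) : Layer n) := fun V =>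
    measurable_const.prodMk (measurable_const.prodMk measurable_id)
  rw [typedLayer, Measure.bind_apply hS Measurable.of_discrete.aemeasurable, lintegral_fintype]
  refine Finset.sum_congr rfl fun V _ => ?_
  rw [mul_comm, Measure.map_apply (hm V) hS, ← lintegral_indicator_one (hm V hS),
    lintegral_fintype]
  congr 1
  refine Finset.sum_congr rfl fun f _ => ?_
  rw [mul_comm]
  rfl

theorem measurable_typedLayer : Measurable (typedLayer n) := by
  refine Measure.measurable_of_measurable_coe _ fun S hS => ?_
  simp only [typedLayer_apply _ hS]
  refine Finset.measurable_sum _ fun V _ => ?_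
  refine (measurable_vertexMeasure_singleton V).mul ?_
  refine Finset.measurable_sum _ fun f _ => ?_
  refine ((measurable_edgeMeasure_singleton V f).comp measurable_snd).mul ?_
  have hm : Measurable fun p : ℕ × ℝ => ((p, V, f) : Layer n) :=
    measurable_id.prodMk measurable_const
  exact (measurable_const.indicator hS : Measurable (S.indicator (1 : Layer n → ℝ≥0∞))).comp hm

theorem measurableSet_layerEdges (E : Finset (Sym2 (Fin n))) :
    MeasurableSet {L : Layer n | layerEdges L = E} :=
  measurable_snd (MeasurableSet.of_discrete
    (s := {q : Finset (Fin n) × (Sym2 (Fin n) → Bool) | edgesOf q.1 q.2 = E}))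

/-- The law of the edge set of a layer. -/
def edgeLaw (n : ℕ) (Q : Measure (ℕ × ℝ)) (E : Finset (Sym2 (Fin n))) : ℝ :=
  (layerMeasure n Q).real {L | layerEdges L = E}

theorem edgeLaw_nonneg (Q : Measure (ℕ × ℝ)) (E : Finset (Sym2 (Fin n))) : 0 ≤ edgeLaw n Q E :=
  measureReal_nonneg

theorem ofReal_condMean_ind (p : ℕ × ℝ) (E : Finset (Sym2 (Fin n))) :
    typedLayer n p {L | layerEdges L = E} = ENNReal.ofReal (condMean n p fun E' => ind (E' = E)) := by
  rw [typedLayer_apply _ (measurableSet_layerEdges E), condMean,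
    ENNReal.ofReal_sum_of_nonneg fun V _ => mul_nonneg measureReal_nonneg
      (Finset.sum_nonneg fun f _ => mul_nonneg measureReal_nonneg (ind_nonneg _))]
  refine Finset.sum_congr rfl fun V _ => ?_
  rw [ENNReal.ofReal_mul measureReal_nonneg, ofReal_measureReal,
    ENNReal.ofReal_sum_of_nonneg fun f _ => mul_nonneg measureReal_nonneg (ind_nonneg _)]
  congr 1
  refine Finset.sum_congr rfl fun f _ => ?_
  rw [ENNReal.ofReal_mul measureReal_nonneg, ofReal_measureReal]
  congr 1
  by_cases h : edgesOf V f = E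
  · have : layerEdges ((p, V, f) : Layer n) = E := h
    simp [ind_true h, this]
  · have : ¬layerEdges ((p, V, f) : Layer n) = E := h
    simp [ind_false h, this]

theorem edgeLaw_eq_integral (Q : Measure (ℕ × ℝ)) (E : Finset (Sym2 (Fin n))) :
    edgeLaw n Q E = ∫ p, condMean n p (fun E' => ind (E' = E)) ∂Q := by
  have h : layerMeasure n Q = Q.bind (typedLayer n) := rfl
  have h0 : ∀ p, 0 ≤ condMean n p fun E' => ind (E' = E) := fun p =>
    condMean_nonneg p fun _ => ind_nonneg _
  have h1 := integral_eq_lintegral_of_nonneg_ae (μ := Q) (ae_of_all _ h0)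
    (measurable_condMean _).aestronglyMeasurable
  rw [edgeLaw, measureReal_def, h,
    Measure.bind_apply (measurableSet_layerEdges E) measurable_typedLayer.aemeasurable, h1]
  simp only [ofReal_condMean_ind]

theorem condMean_sum {ι : Type*} (S : Finset ι) (p : ℕ × ℝ) (c : ι → ℝ)
    (Φ : ι → Finset (Sym2 (Fin n)) → ℝ) :
    condMean n p (fun E => ∑ i ∈ S, Φ i E * c i) = ∑ i ∈ S, condMean n p (Φ i) * c i := by
  simp only [condMean, Finset.mul_sum, Finset.sum_mul]
  rw [Finset.sum_comm (s := S)]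
  refine Finset.sum_congr rfl fun V _ => ?_
  rw [Finset.sum_comm (s := S)]
  refine Finset.sum_congr rfl fun f _ => Finset.sum_congr rfl fun i _ => ?_
  ring

theorem condMean_mono (p : ℕ × ℝ) {Φ Ψ : Finset (Sym2 (Fin n)) → ℝ} (h : ∀ E, Φ E ≤ Ψ E) :
    condMean n p Φ ≤ condMean n p Ψ :=
  Finset.sum_le_sum fun _ _ => mul_le_mul_of_nonneg_left
    (Finset.sum_le_sum fun _ _ => mul_le_mul_of_nonneg_left (h _) measureReal_nonneg)
    measureReal_nonneg

theorem integrable_condMean_ind (Q : Measure (ℕ × ℝ)) [IsProbabilityMeasure Q]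
    (A : Finset (Sym2 (Fin n)) → Prop) :
    Integrable (fun p => condMean n p fun E => ind (A E)) Q := by
  refine Integrable.of_bound (measurable_condMean _).aestronglyMeasurable 1 (ae_of_all _ fun p => ?_)
  rw [Real.norm_eq_abs, abs_of_nonneg (condMean_nonneg p fun _ => ind_nonneg _), ← condMean_one n p]
  exact condMean_mono p fun _ => ind_le_one _

theorem mean_edgeLaw (Q : Measure (ℕ × ℝ)) [IsProbabilityMeasure Q]
    (Φ : Finset (Sym2 (Fin n)) → ℝ) :
    mean (edgeLaw n Q) Φ = ∫ p, condMean n p Φ ∂Q := by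
  have h : Φ = fun E => ∑ E', ind (E = E') * Φ E' := by
    funext E
    simp [ind]
  conv_rhs => rw [h]
  simp only [condMean_sum]
  rw [integral_finsetSum _ fun E _ => (integrable_condMean_ind Q _).mul_const _]
  simp only [mean, edgeLaw_eq_integral, integral_mul_const]

theorem sum_edgeLaw (Q : Measure (ℕ × ℝ)) [IsProbabilityMeasure Q] : ∑ E, edgeLaw n Q E = 1 := by
  have h := mean_edgeLaw (n := n) Q fun _ => 1
  simpa [mean, condMean_one] using h

theorem modelMeasure_real (m : ℕ) (Q : Measure (ℕ × ℝ)) [IsProbabilityMeasure Q]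
    (A : (Fin m → Finset (Sym2 (Fin n))) → Prop) :
    MeasurableSet {ω : Fin m → Layer n | A fun k => layerEdges (ω k)} ∧
    (modelMeasure n m Q).real {ω | A fun k => layerEdges (ω k)} =
      prodMean (edgeLaw n Q) m fun E => ind (A E) := by
  have hm : ∀ E : Fin m → Finset (Sym2 (Fin n)), MeasurableSet
      (Set.univ.pi fun k => {L : Layer n | layerEdges L = E k}) := fun E =>
    MeasurableSet.univ_pi fun k => measurableSet_layerEdges _
  have hU : {ω : Fin m → Layer n | A fun k => layerEdges (ω k)} =
      ⋃ E ∈ (Finset.univ.filter A), Set.univ.pi fun k => {L : Layer n | layerEdges L = E k} := by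
    ext ω
    simp only [Set.mem_ofPred_eq, Set.mem_iUnion, Finset.mem_filter, Finset.mem_univ, true_and,
      Set.mem_pi, Set.mem_univ, forall_const, exists_prop]
    constructor
    · exact fun h => ⟨_, h, fun _ => rfl⟩
    · rintro ⟨E, hE, h⟩
      rwa [funext h]
  rw [hU]
  refine ⟨Finset.measurableSet_biUnion _ fun E _ => hm E, ?_⟩
  have : IsFiniteMeasure (modelMeasure n m Q) := by unfold modelMeasure; infer_instance
  rw [measureReal_biUnion_finset _ fun E _ => hm E]
  · rw [prodMean, Finset.sum_filter]
    refine Finset.sum_congr rfl fun E _ => ?_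
    have : (modelMeasure n m Q).real (Set.univ.pi fun k => {L : Layer n | layerEdges L = E k}) =
        ∏ k, edgeLaw n Q (E k) := by
      rw [modelMeasure, measureReal_def, Measure.pi_pi, ENNReal.toReal_prod]
      rfl
    by_cases h : A E <;> simp [h, this, ind]
  · intro E _ E' _ hne
    rw [Function.onFun, Set.disjoint_left]
    intro ω h1 h2
    refine hne (funext fun k => ?_)
    have h3 : layerEdges (ω k) = E k := h1 k trivial
    have h4 : layerEdges (ω k) = E' k := h2 k trivial
    rw [← h3, h4]

theorem exists_val_iff {i : ℕ} (hi : i < n) (e : Sym2 (Fin n)) :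
    (∃ v : Fin n, v ∈ e ∧ (v : ℕ) = i) ↔ (⟨i, hi⟩ : Fin n) ∈ e := by
  constructor
  · rintro ⟨v, hv, rfl⟩
    exact hv
  · exact fun h => ⟨_, h, rfl⟩

theorem bidegree_eq_div (hn : 2 ≤ n) (m : ℕ) (Q : Measure (ℕ × ℝ)) [IsProbabilityMeasure Q]
    {a b : Fin n} (ha : a = ⟨0, by lia⟩) (hb : b = ⟨1, by lia⟩) (s t : ℕ) :
    bidegree n m Q s t =
      prodMean (edgeLaw n Q) m (fun E => ind (s(a, b) ∈ Finset.univ.biUnion E ∧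
        edgeDeg a (Finset.univ.biUnion E) = s ∧ edgeDeg b (Finset.univ.biUnion E) = t)) /
      prodMean (edgeLaw n Q) m fun E => ind (s(a, b) ∈ Finset.univ.biUnion E) := by
  have hab : a ≠ b := by rw [ha, hb]; simp
  have h1 : adjEvent n m = {ω | s(a, b) ∈ Finset.univ.biUnion fun k => layerEdges (ω k)} := by
    ext ω
    simp only [adjEvent, Set.mem_ofPred_eq, exists_val_iff (show 0 < n by lia),
      exists_val_iff (show 1 < n by lia), ← ha, ← hb]
    constructor
    · rintro ⟨e, he, h⟩
      rw [← (Sym2.mem_and_mem_iff hab).1 h]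
      exact he
    · exact fun h => ⟨_, h, by simp⟩
  have h2 : {ω : Fin m → Layer n | deg ω 0 = s ∧ deg ω 1 = t} =
      {ω | edgeDeg a (Finset.univ.biUnion fun k => layerEdges (ω k)) = s ∧
        edgeDeg b (Finset.univ.biUnion fun k => layerEdges (ω k)) = t} := by
    ext ω
    simp only [deg, edgeDeg, exists_val_iff (show 0 < n by lia),
      exists_val_iff (show 1 < n by lia), ← ha, ← hb, graphEdges]
  rw [bidegree, h1, h2, cond_apply (modelMeasure_real m Q fun E =>
    s(a, b) ∈ Finset.univ.biUnion E).1, ENNReal.toReal_mul, ENNReal.toReal_inv,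
    ← (modelMeasure_real m Q fun E => s(a, b) ∈ Finset.univ.biUnion E).2,
    ← (modelMeasure_real m Q fun E => s(a, b) ∈ Finset.univ.biUnion E ∧
        edgeDeg a (Finset.univ.biUnion E) = s ∧ edgeDeg b (Finset.univ.biUnion E) = t).2,
    inv_mul_eq_div]
  rfl

end Law

section Moments

theorem tendsto_of_truncation {a : ℕ → ℝ} {a' : ℝ} {J T : ℕ → ℕ → ℝ} {J' T' : ℕ → ℝ}
    (hJ : ∀ K, Tendsto (fun n => J n K) atTop (𝓝 (J' K)))
    (hT : ∀ K, Tendsto (fun n => T n K) atTop (𝓝 (T' K)))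
    (hT' : Tendsto T' atTop (𝓝 0)) (ha : ∀ n K, |a n - J n K| ≤ T n K)
    (ha' : ∀ K, |a' - J' K| ≤ T' K) : Tendsto a atTop (𝓝 a') := by
  rw [Metric.tendsto_atTop]
  intro ε hε
  obtain ⟨K, hK⟩ := (hT'.eventually (gt_mem_nhds (show (0 : ℝ) < ε / 4 by linarith))).exists
  have h1 := (hT K).eventually (gt_mem_nhds hK)
  have h2 := (hJ K).eventually (Metric.ball_mem_nhds _ (show (0 : ℝ) < ε / 4 by linarith))
  obtain ⟨N, hN⟩ := eventually_atTop.1 (h1.and h2)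
  refine ⟨N, fun n hn => ?_⟩
  obtain ⟨h3, h4⟩ := hN n hn
  have h5 := ha n K
  have h6 := ha' K
  simp only [Real.dist_eq] at h4 ⊢
  rw [abs_le] at h5 h6
  rw [abs_lt] at h4 ⊢
  constructor <;> linarith [h5.1, h5.2, h6.1, h6.2, h4.1, h4.2]

/-- Restriction of a function of the layer type to layers of size at most `K`. -/
def trunc (K : ℕ) (F : ℕ × ℝ → ℝ) (p : ℕ × ℝ) : ℝ := if p.1 ≤ K then F p else 0

theorem measurable_trunc (K : ℕ) {F : ℕ × ℝ → ℝ} (hF : Measurable F) : Measurable (trunc K F) :=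
  Measurable.ite (measurable_fst (MeasurableSet.of_discrete (s := {x : ℕ | x ≤ K}))) hF
    measurable_const

/-- Projection of the strength to the unit interval. -/
def clamp (y : ℝ) : ℝ := max 0 (min y 1)

theorem clamp_mem (y : ℝ) : clamp y ∈ Set.Icc (0 : ℝ) 1 :=
  ⟨le_max_left _ _, max_le zero_le_one (min_le_right _ _)⟩

theorem clamp_eq {y : ℝ} (hy : y ∈ Set.Icc (0 : ℝ) 1) : clamp y = y := by
  rw [clamp, min_eq_left hy.2, max_eq_right hy.1]

theorem continuous_clamp : Continuous clamp := by unfold clamp; fun_prop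

theorem measurable_of_continuous_sections {G : ℕ × ℝ → ℝ}
    (hG : ∀ x, Continuous fun y => G (x, y)) : Measurable G := by
  have : Continuous (Function.uncurry fun x y => G (x, y)) :=
    continuous_prod_of_discrete_left.2 hG
  exact this.measurable

theorem exists_bound_trunc {G : ℕ × ℝ → ℝ} (hG : ∀ x, Continuous fun y => G (x, y)) (K : ℕ) :
    ∃ M, ∀ x y, |trunc K G (x, clamp y)| ≤ M := by
  have h : ∀ x, ∃ M, ∀ y ∈ Set.Icc (0 : ℝ) 1, ‖G (x, y)‖ ≤ M := fun x =>
    isCompact_Icc.exists_bound_of_continuousOn (hG x).continuousOn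
  choose M hM using h
  refine ⟨∑ x ∈ Finset.range (K + 1), |M x|, fun x y => ?_⟩
  rw [trunc]
  split_ifs with hx
  · have h1 := hM x _ (clamp_mem y)
    refine (h1.trans (le_abs_self _)).trans ?_
    exact Finset.single_le_sum (f := fun x => |M x|) (fun _ _ => abs_nonneg _)
      (Finset.mem_range_succ_iff.2 hx)
  · rw [abs_zero]
    exact Finset.sum_nonneg fun _ _ => abs_nonneg _

variable {Pn : ℕ → ProbabilityMeasure (ℕ × ℝ)} {P : ProbabilityMeasure (ℕ × ℝ)}

theorem tendsto_integral_trunc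
    (hs : ∀ n, ∀ᵐ p ∂(Pn n : Measure (ℕ × ℝ)), p.1 ≤ n ∧ p.2 ∈ Set.Icc (0 : ℝ) 1)
    (hPs : ∀ᵐ p ∂(P : Measure (ℕ × ℝ)), p.2 ∈ Set.Icc (0 : ℝ) 1)
    (hweak : Tendsto Pn atTop (𝓝 P)) {G : ℕ × ℝ → ℝ}
    (hG : ∀ x, Continuous fun y => G (x, y)) (K : ℕ) :
    Tendsto (fun n => ∫ p, trunc K G p ∂(Pn n : Measure (ℕ × ℝ))) atTop
      (𝓝 (∫ p, trunc K G p ∂(P : Measure (ℕ × ℝ)))) := by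
  obtain ⟨M, hM⟩ := exists_bound_trunc hG K
  have hc : Continuous (Function.uncurry fun x y => trunc K G (x, clamp y)) := by
    refine continuous_prod_of_discrete_left.2 fun x => ?_
    simp only [Function.uncurry, trunc]
    by_cases hx : x ≤ K
    · simp only [hx, if_true]
      exact (hG x).comp continuous_clamp
    · simp only [hx, if_false]
      exact continuous_const
  let g : BoundedContinuousFunction (ℕ × ℝ) ℝ :=
    BoundedContinuousFunction.ofNormedAddCommGroup _ hc M fun p => hM p.1 p.2
  have h := ProbabilityMeasure.tendsto_iff_forall_integral_tendsto.1 hweak g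
  have e1 : ∀ n, ∫ p, g p ∂(Pn n : Measure (ℕ × ℝ)) =
      ∫ p, trunc K G p ∂(Pn n : Measure (ℕ × ℝ)) := fun n => by
    refine integral_congr_ae ((hs n).mono fun p hp => ?_)
    change trunc K G (p.1, clamp p.2) = _
    rw [clamp_eq hp.2]
  have e2 : ∫ p, g p ∂(P : Measure (ℕ × ℝ)) = ∫ p, trunc K G p ∂(P : Measure (ℕ × ℝ)) := by
    refine integral_congr_ae (hPs.mono fun p hp => ?_)
    change trunc K G (p.1, clamp p.2) = _
    rw [clamp_eq hp]
  rw [e2] at h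
  exact h.congr e1

theorem integrable_trunc {Q : Measure (ℕ × ℝ)} [IsProbabilityMeasure Q]
    (hQ : ∀ᵐ p ∂Q, p.2 ∈ Set.Icc (0 : ℝ) 1) {G : ℕ × ℝ → ℝ}
    (hG : ∀ x, Continuous fun y => G (x, y)) (K : ℕ) : Integrable (trunc K G) Q := by
  obtain ⟨M, hM⟩ := exists_bound_trunc hG K
  refine Integrable.of_bound
    (measurable_trunc K (measurable_of_continuous_sections hG)).aestronglyMeasurable M
    (hQ.mono fun p hp => ?_)
  have := hM p.1 p.2
  rwa [clamp_eq hp] at this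

theorem integrable_of_support {Q : Measure (ℕ × ℝ)} [IsProbabilityMeasure Q] {n : ℕ}
    (hQ : ∀ᵐ p ∂Q, p.1 ≤ n ∧ p.2 ∈ Set.Icc (0 : ℝ) 1) {G : ℕ × ℝ → ℝ}
    (hG : ∀ x, Continuous fun y => G (x, y)) : Integrable G Q :=
  (integrable_trunc (hQ.mono fun _ h => h.2) hG n).congr (hQ.mono fun _ h => if_pos h.1)

theorem abs_integral_sub_trunc_le {Q : Measure (ℕ × ℝ)} {F φ : ℕ × ℝ → ℝ} {C : ℝ} (K : ℕ)
    (hF : AEStronglyMeasurable F Q) (hφ : Integrable φ Q) (h0 : ∀ᵐ p ∂Q, |F p| ≤ C * φ p) :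
    |∫ p, F p ∂Q - ∫ p, trunc K F p ∂Q| ≤ C * (∫ p, φ p ∂Q - ∫ p, trunc K φ p ∂Q) := by
  have hm : MeasurableSet {p : ℕ × ℝ | p.1 ≤ K} :=
    measurable_fst (MeasurableSet.of_discrete (s := {x : ℕ | x ≤ K}))
  have htr : ∀ {H : ℕ × ℝ → ℝ}, Integrable H Q → Integrable (trunc K H) Q := fun h =>
    (h.indicator hm).congr (ae_of_all _ fun p => by
      simp [trunc, Set.indicator])
  have hFi : Integrable F Q := (hφ.const_mul C).mono' hF h0
  rw [← integral_sub hFi (htr hFi), ← integral_sub hφ (htr hφ), ← integral_const_mul]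
  refine (norm_integral_le_integral_norm (μ := Q) (fun p => F p - trunc K F p)).trans ?_
  refine integral_mono_ae (hFi.sub (htr hFi)).norm ((hφ.sub (htr hφ)).const_mul C)
    (h0.mono fun p hp => ?_)
  simp only [trunc, Real.norm_eq_abs]
  split_ifs
  · simp
  · simpa using hp

theorem tendsto_integral_sub_trunc {Q : Measure (ℕ × ℝ)} {φ : ℕ × ℝ → ℝ} (hφ : Integrable φ Q) :
    Tendsto (fun K => ∫ p, φ p ∂Q - ∫ p, trunc K φ p ∂Q) atTop (𝓝 0) := by
  have hm : ∀ K, MeasurableSet {p : ℕ × ℝ | p.1 ≤ K} := fun K =>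
    measurable_fst (MeasurableSet.of_discrete (s := {x : ℕ | x ≤ K}))
  have h : Tendsto (fun K => ∫ p, trunc K φ p ∂Q) atTop (𝓝 (∫ p, φ p ∂Q)) := by
    refine tendsto_integral_of_dominated_convergence (fun p => ‖φ p‖) (fun K => ?_) hφ.norm
      (fun K => ae_of_all _ fun p => ?_) (ae_of_all _ fun p => ?_)
    · exact ((hφ.indicator (hm K)).congr (ae_of_all _ fun p => by
        simp [trunc, Set.indicator])).aestronglyMeasurable
    · rw [trunc]; split_ifs <;> simp
    · refine tendsto_const_nhds.congr' ?_
      filter_upwards [eventually_ge_atTop p.1] with K hK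
      exact (if_pos hK).symm
  simpa using (tendsto_const_nhds (x := ∫ p, φ p ∂Q)).sub h

theorem tendsto_integral_of_dominated_moment
    (hs : ∀ n, ∀ᵐ p ∂(Pn n : Measure (ℕ × ℝ)), p.1 ≤ n ∧ p.2 ∈ Set.Icc (0 : ℝ) 1)
    (hPs : ∀ᵐ p ∂(P : Measure (ℕ × ℝ)), p.2 ∈ Set.Icc (0 : ℝ) 1)
    (hweak : Tendsto Pn atTop (𝓝 P)) {φ : ℕ × ℝ → ℝ}
    (hφc : ∀ x, Continuous fun y => φ (x, y)) (hφi : Integrable φ (P : Measure (ℕ × ℝ)))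
    (hφ : Tendsto (fun n => ∫ p, φ p ∂(Pn n : Measure (ℕ × ℝ))) atTop
      (𝓝 (∫ p, φ p ∂(P : Measure (ℕ × ℝ)))))
    {F : ℕ → ℕ × ℝ → ℝ} {G : ℕ × ℝ → ℝ} (C : ℝ)
    (hFc : ∀ n x, Continuous fun y => F n (x, y)) (hGc : ∀ x, Continuous fun y => G (x, y))
    (hF : ∀ n p, p.1 ≤ n → p.2 ∈ Set.Icc (0 : ℝ) 1 → |F n p| ≤ C * φ p)
    (hG : ∀ p : ℕ × ℝ, p.2 ∈ Set.Icc (0 : ℝ) 1 → |G p| ≤ C * φ p)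
    (hFG : ∀ K : ℕ, ∀ ε > 0, ∀ᶠ n in atTop, ∀ p : ℕ × ℝ, p.1 ≤ K → p.2 ∈ Set.Icc (0 : ℝ) 1 →
      |F n p - G p| ≤ ε) :
    Tendsto (fun n => ∫ p, F n p ∂(Pn n : Measure (ℕ × ℝ))) atTop
      (𝓝 (∫ p, G p ∂(P : Measure (ℕ × ℝ)))) := by
  refine tendsto_of_truncation
    (J := fun n K => ∫ p, trunc K (F n) p ∂(Pn n : Measure (ℕ × ℝ)))
    (J' := fun K => ∫ p, trunc K G p ∂(P : Measure (ℕ × ℝ)))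
    (T := fun n K => C * (∫ p, φ p ∂(Pn n : Measure (ℕ × ℝ)) -
      ∫ p, trunc K φ p ∂(Pn n : Measure (ℕ × ℝ))))
    (T' := fun K => C * (∫ p, φ p ∂(P : Measure (ℕ × ℝ)) -
      ∫ p, trunc K φ p ∂(P : Measure (ℕ × ℝ)))) (fun K => ?_) (fun K => ?_) ?_
      (fun n K => ?_) (fun K => ?_)
  · have h1 := tendsto_integral_trunc hs hPs hweak hGc K
    have h2 : Tendsto (fun n => ∫ p, trunc K (F n) p ∂(Pn n : Measure (ℕ × ℝ)) -
        ∫ p, trunc K G p ∂(Pn n : Measure (ℕ × ℝ))) atTop (𝓝 0) := by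
      rw [Metric.tendsto_atTop]
      intro ε hε
      obtain ⟨N, hN⟩ := eventually_atTop.1 (hFG K (ε / 2) (half_pos hε))
      refine ⟨N, fun n hn => ?_⟩
      have hs' := (hs n).mono fun _ h => h.2
      rw [dist_zero_right, ← integral_sub (integrable_trunc hs' (hFc n) K)
        (integrable_trunc hs' hGc K)]
      refine lt_of_le_of_lt (norm_integral_le_of_norm_le_const (C := ε / 2)
        (hs'.mono fun p hp => ?_)) ?_
      · simp only [trunc, Real.norm_eq_abs]
        split_ifs with hx
        · exact hN n hn p hx hp
        · simpa using (half_pos hε).le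
      · simp [hε]
    simpa using h2.add h1
  · exact (hφ.sub (tendsto_integral_trunc hs hPs hweak hφc K)).const_mul C
  · simpa using (tendsto_integral_sub_trunc hφi).const_mul C
  · exact abs_integral_sub_trunc_le K
      (measurable_of_continuous_sections (hFc n)).aestronglyMeasurable
      (integrable_of_support (hs n) hφc) ((hs n).mono fun p hp => hF n p hp.1 hp.2)
  · exact abs_integral_sub_trunc_le K
      (measurable_of_continuous_sections hGc).aestronglyMeasurable hφi
      (hPs.mono fun p hp => hG p hp)

end Moments

section Limits

theorem continuous_binP (k s : ℕ) : Continuous fun y => binP k y s := by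
  unfold binP; fun_prop

theorem continuous_bicoeff_monom_mul_binXY (k s t : ℕ) :
    Continuous fun y => bicoeff s t (monom 1 1 * binXY k y) := by
  have := continuous_binP k
  simp only [bicoeff_mul, bicoeff_binXY]
  fun_prop

theorem continuous_bicoeff_inX (k s t : ℕ) :
    Continuous fun y => bicoeff s t (inX (PowerSeries.mk (binP k y))) := by
  have := continuous_binP k
  simp only [bicoeff_inX, PowerSeries.coeff_mk]
  fun_prop

theorem continuous_bicoeff_inY (k s t : ℕ) :
    Continuous fun y => bicoeff s t (inY (PowerSeries.mk (binP k y))) := by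
  have := continuous_binP k
  simp only [bicoeff_inY, PowerSeries.coeff_mk]
  fun_prop

theorem continuous_bicoeff_pairTerm (x s t : ℕ) :
    Continuous fun y => bicoeff s t (pairTerm x y) := by
  have h0 := continuous_binP (x - 2)
  have h1 := continuous_bicoeff_monom_mul_binXY (x - 2) s t
  have h2 := continuous_bicoeff_inX (x - 1) s t
  have h3 := continuous_bicoeff_inY (x - 1) s t
  have e : ∀ y, bicoeff s t (pairTerm x y) = (1 - y) * (binP (x - 2) y s * binP (x - 2) y t) +
      y * bicoeff s t (monom 1 1 * binXY (x - 2) y) -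
      bicoeff s t (inX (PowerSeries.mk (binP (x - 1) y))) -
      bicoeff s t (inY (PowerSeries.mk (binP (x - 1) y))) + bicoeff s t 1 := fun y => by
    rw [pairTerm, map_add, map_sub, map_sub, add_mul, map_add, bicoeff_scalar_mul, mul_assoc,
      bicoeff_scalar_mul, bicoeff_binXY]
  simp only [e]
  fun_prop

/-- The coefficient at `(s, t)` of the joint degree generating function of a layer of type `p`. -/
def degCoeff (n s t : ℕ) (p : ℕ × ℝ) : ℝ :=
  bicoeff s t 1 + (p.1 : ℝ) / n * bicoeff s t (inX (PowerSeries.mk (binP (p.1 - 1) p.2)) - 1) +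
    (p.1 : ℝ) / n * bicoeff s t (inY (PowerSeries.mk (binP (p.1 - 1) p.2)) - 1) +
    (p.1.descFactorial 2 : ℝ) / n.descFactorial 2 * bicoeff s t (pairTerm p.1 p.2)

theorem continuous_degCoeff (n s t x : ℕ) : Continuous fun y => degCoeff n s t (x, y) := by
  have h1 := continuous_bicoeff_pairTerm x s t
  have h2 := continuous_bicoeff_inX (x - 1) s t
  have h3 := continuous_bicoeff_inY (x - 1) s t
  simp only [degCoeff, map_sub]
  fun_prop

/-- The linear part of the joint degree generating function. -/
def degSlope (s t : ℕ) (p : ℕ × ℝ) : ℝ :=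
  (p.1 : ℝ) * (bicoeff s t (inX (PowerSeries.mk (binP (p.1 - 1) p.2)) - 1) +
    bicoeff s t (inY (PowerSeries.mk (binP (p.1 - 1) p.2)) - 1))

theorem continuous_degSlope (s t x : ℕ) : Continuous fun y => degSlope s t (x, y) := by
  have h2 := continuous_bicoeff_inX (x - 1) s t
  have h3 := continuous_bicoeff_inY (x - 1) s t
  simp only [degSlope, map_sub]
  fun_prop

theorem abs_degSlope_le (s t : ℕ) {p : ℕ × ℝ} (hy : p.2 ∈ Set.Icc (0 : ℝ) 1) :
    |degSlope s t p| ≤ 4 * p.1 := by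
  have h1 := abs_bicoeff_inX_le hy (p.1 - 1) s t
  have h2 := abs_bicoeff_inY_le hy (p.1 - 1) s t
  have h3 := abs_bicoeff_one_le s t
  rw [degSlope, abs_mul, Nat.abs_cast, mul_comm, map_sub, map_sub]
  refine mul_le_mul_of_nonneg_right ?_ (Nat.cast_nonneg _)
  rw [abs_le] at *
  constructor <;> linarith [h1.1, h1.2, h2.1, h2.2, h3.1, h3.2]

theorem abs_scaled_degCoeff_sub_le {n : ℕ} (hn : 2 ≤ n) (s t : ℕ) {p : ℕ × ℝ}
    (hy : p.2 ∈ Set.Icc (0 : ℝ) 1) :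
    |(n : ℝ) * (degCoeff n s t p - bicoeff s t 1) - degSlope s t p| ≤
      p.1 * (p.1 - 1) / (n - 1) * ((s + 1) * (t + 1) + 3) := by
  have h := abs_bicoeff_pairTerm_le hy p.1 s t
  have hn' : (2 : ℝ) ≤ n := by exact_mod_cast hn
  have h0 : (0 : ℝ) ≤ (p.1 : ℝ) * (p.1 - 1) := by
    rw [← Nat.cast_descFactorial_two]
    positivity
  have h1 : (n : ℝ) * (degCoeff n s t p - bicoeff s t 1) - degSlope s t p =
      p.1 * (p.1 - 1) / (n - 1) * bicoeff s t (pairTerm p.1 p.2) := by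
    have e1 : (n : ℝ) ≠ 0 := by linarith
    have e2 : (n : ℝ) - 1 ≠ 0 := by linarith
    rw [degCoeff, degSlope, Nat.cast_descFactorial_two, Nat.cast_descFactorial_two]
    field_simp
    ring
  have h2 : (0 : ℝ) ≤ p.1 * (p.1 - 1) / (n - 1) := div_nonneg h0 (by linarith)
  rw [h1, abs_mul, abs_of_nonneg h2]
  exact mul_le_mul_of_nonneg_left h h2

theorem mul_sub_one_div_le {n x : ℕ} (hn : 2 ≤ n) (hx : x ≤ n) :
    (x : ℝ) * (x - 1) / (n - 1) ≤ x := by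
  have hn' : (2 : ℝ) ≤ n := by exact_mod_cast hn
  have hx' : (x : ℝ) ≤ n := by exact_mod_cast hx
  rw [div_le_iff₀ (by linarith)]
  exact mul_le_mul_of_nonneg_left (by linarith) (Nat.cast_nonneg _)

theorem abs_scaled_degCoeff_le {n : ℕ} (s t : ℕ) {p : ℕ × ℝ} (hx : p.1 ≤ n)
    (hy : p.2 ∈ Set.Icc (0 : ℝ) 1) :
    |(n : ℝ) * (degCoeff n s t p - bicoeff s t 1)| ≤ (4 + ((s + 1) * (t + 1) + 3)) * p.1 := by
  have hp : (0 : ℝ) ≤ p.1 := Nat.cast_nonneg _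
  have h1 := abs_degSlope_le s t hy
  have hD : (0 : ℝ) ≤ (s + 1) * (t + 1) + 3 := by positivity
  rcases lt_or_ge n 2 with hn | hn
  · have h2 : (n : ℝ) * (degCoeff n s t p - bicoeff s t 1) = n / n * degSlope s t p := by
      rw [degCoeff, degSlope, Nat.descFactorial_eq_zero_iff_lt.2 hn]
      simp only [Nat.cast_zero, div_zero, zero_mul]
      ring
    have h3 : |(n : ℝ) / n| ≤ 1 := by
      rw [abs_of_nonneg (by positivity)]
      exact div_self_le_one _
    rw [h2, abs_mul]
    calc _ ≤ 1 * (4 * (p.1 : ℝ)) := mul_le_mul h3 h1 (abs_nonneg _) zero_le_one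
      _ ≤ _ := by nlinarith
  · have h2 := abs_scaled_degCoeff_sub_le hn s t hy
    have h3 := mul_le_mul_of_nonneg_right (mul_sub_one_div_le hn hx) hD
    have h4 := abs_add_le (degSlope s t p)
      ((n : ℝ) * (degCoeff n s t p - bicoeff s t 1) - degSlope s t p)
    rw [add_sub_cancel] at h4
    nlinarith

theorem tendsto_const_div_sub (c d : ℝ) : Tendsto (fun n : ℕ => c / ((n : ℝ) - d)) atTop (𝓝 0) :=
  Tendsto.const_div_atTop (tendsto_atTop_add_const_right _ _ tendsto_natCast_atTop_atTop) _

variable {Pn : ℕ → ProbabilityMeasure (ℕ × ℝ)} {P : ProbabilityMeasure (ℕ × ℝ)}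

theorem tendsto_degCoeff
    (hs : ∀ n, ∀ᵐ p ∂(Pn n : Measure (ℕ × ℝ)), p.1 ≤ n ∧ p.2 ∈ Set.Icc (0 : ℝ) 1)
    (hPs : ∀ᵐ p ∂(P : Measure (ℕ × ℝ)), p.2 ∈ Set.Icc (0 : ℝ) 1)
    (hweak : Tendsto Pn atTop (𝓝 P)) (hi : Integrable (fun p => (p.1 : ℝ)) (P : Measure (ℕ × ℝ)))
    (h10 : Tendsto (fun n => ∫ p, (p.1 : ℝ) ∂(Pn n : Measure (ℕ × ℝ))) atTop
      (𝓝 (∫ p, (p.1 : ℝ) ∂(P : Measure (ℕ × ℝ))))) (s t : ℕ) :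
    Tendsto (fun n : ℕ => (n : ℝ) * (∫ p, degCoeff n s t p ∂(Pn n : Measure (ℕ × ℝ)) -
      bicoeff s t 1)) atTop (𝓝 (∫ p, degSlope s t p ∂(P : Measure (ℕ × ℝ)))) := by
  have h := tendsto_integral_of_dominated_moment hs hPs hweak (φ := fun p => (p.1 : ℝ))
    (fun x => by dsimp only; exact continuous_const) hi h10
    (F := fun n p => (n : ℝ) * (degCoeff n s t p - bicoeff s t 1)) (G := degSlope s t)
    (4 + ((s + 1) * (t + 1) + 3))
    (fun n x => continuous_const.mul ((continuous_degCoeff n s t x).sub continuous_const))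
    (continuous_degSlope s t) (fun n p hx hy => abs_scaled_degCoeff_le s t hx hy)
    (fun p hy => (abs_degSlope_le s t hy).trans
      (mul_le_mul_of_nonneg_right (by nlinarith [show (0 : ℝ) ≤ (s + 1) * (t + 1) by positivity])
        (Nat.cast_nonneg _)))
    (fun K ε hε => by
      have h1 := (tendsto_const_div_sub ((K : ℝ) * K * ((s + 1) * (t + 1) + 3)) 1).eventually
        (gt_mem_nhds hε)
      filter_upwards [h1, eventually_ge_atTop 2] with n h1 hn p hx hy
      refine (abs_scaled_degCoeff_sub_le hn s t hy).trans (le_trans ?_ h1.le)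
      have hn' : (2 : ℝ) ≤ n := by exact_mod_cast hn
      have hx' : (p.1 : ℝ) ≤ K := by exact_mod_cast hx
      have hp : (0 : ℝ) ≤ p.1 := Nat.cast_nonneg _
      rw [div_mul_eq_mul_div]
      refine div_le_div_of_nonneg_right ?_ (by linarith)
      refine mul_le_mul_of_nonneg_right ?_ (by positivity)
      nlinarith)
  refine h.congr fun n => ?_
  rw [integral_const_mul, integral_sub (integrable_of_support (hs n) (continuous_degCoeff n s t))
    (integrable_const _), integral_const, probReal_univ, one_smul]

theorem integral_degSlope (hPs : ∀ᵐ p ∂(P : Measure (ℕ × ℝ)), p.2 ∈ Set.Icc (0 : ℝ) 1)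
    (hi : Integrable (fun p => (p.1 : ℝ)) (P : Measure (ℕ × ℝ)))
    (h10pos : 0 < mom (P : Measure (ℕ × ℝ)) 1 0) (s t : ℕ) :
    ∫ p, degSlope s t p ∂(P : Measure (ℕ × ℝ)) =
      bicoeff s t (scalar (mom (P : Measure (ℕ × ℝ)) 1 0) *
        (inX (PowerSeries.mk (gInc (P : Measure (ℕ × ℝ)))) - 1 +
          (inY (PowerSeries.mk (gInc (P : Measure (ℕ × ℝ)))) - 1))) := by
  have hb : ∀ u, Integrable (fun p : ℕ × ℝ => (p.1 : ℝ) * binP (p.1 - 1) p.2 u)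
      (P : Measure (ℕ × ℝ)) := fun u => by
    refine hi.mono' (measurable_of_continuous_sections fun x => ?_).aestronglyMeasurable
      (hPs.mono fun p hp => ?_)
    · have := continuous_binP (x - 1)
      dsimp only
      fun_prop
    rw [norm_mul, Real.norm_natCast, Real.norm_eq_abs, abs_of_nonneg (binP_nonneg hp _ _)]
    exact mul_le_of_le_one_right (Nat.cast_nonneg _) (binP_le_one hp _ _)
  have hm : mom (P : Measure (ℕ × ℝ)) 1 0 = ∫ p, (p.1 : ℝ) ∂(P : Measure (ℕ × ℝ)) := by
    simp [mom]
  have hg : ∀ u, ∫ p, (p.1 : ℝ) * binP (p.1 - 1) p.2 u ∂(P : Measure (ℕ × ℝ)) =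
      mom (P : Measure (ℕ × ℝ)) 1 0 * gInc (P : Measure (ℕ × ℝ)) u := fun u => by
    rw [gInc, mul_div_cancel₀ _ h10pos.ne']
  have e : ∀ p, degSlope s t p = ((p.1 : ℝ) * binP (p.1 - 1) p.2 s) * (if t = 0 then 1 else 0) +
      ((p.1 : ℝ) * binP (p.1 - 1) p.2 t) * (if s = 0 then 1 else 0) -
      (p.1 : ℝ) * (2 * bicoeff s t 1) := fun p => by
    simp only [degSlope, map_sub, bicoeff_inX, bicoeff_inY, PowerSeries.coeff_mk]
    ring
  have h12 : Integrable (fun p : ℕ × ℝ =>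
      ((p.1 : ℝ) * binP (p.1 - 1) p.2 s) * (if t = 0 then 1 else 0) +
        ((p.1 : ℝ) * binP (p.1 - 1) p.2 t) * (if s = 0 then 1 else 0)) (P : Measure (ℕ × ℝ)) :=
    ((hb s).mul_const _).add ((hb t).mul_const _)
  simp only [e]
  rw [integral_sub h12 (hi.mul_const _),
    integral_add ((hb s).mul_const _) ((hb t).mul_const _), integral_mul_const, integral_mul_const,
    integral_mul_const, hg, hg, ← hm, bicoeff_scalar_mul]
  simp only [map_add, map_sub, bicoeff_inX, bicoeff_inY, PowerSeries.coeff_mk]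
  ring

/-- Size-biased coefficient of the edge generating function of a layer. -/
def pairCoeff (s t : ℕ) (p : ℕ × ℝ) : ℝ :=
  (p.1.descFactorial 2 : ℝ) * p.2 * bicoeff s t (monom 1 1 * binXY (p.1 - 2) p.2)

theorem continuous_pairCoeff (s t x : ℕ) : Continuous fun y => pairCoeff s t (x, y) := by
  have h1 := continuous_bicoeff_monom_mul_binXY (x - 2) s t
  simp only [pairCoeff]
  fun_prop

theorem abs_bicoeff_binXY_le {y : ℝ} (hy : y ∈ Set.Icc (0 : ℝ) 1) (k s t : ℕ) :
    |bicoeff s t (binXY k y)| ≤ 1 := by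
  rw [bicoeff_binXY, abs_of_nonneg (mul_nonneg (binP_nonneg hy _ _) (binP_nonneg hy _ _))]
  exact mul_le_one₀ (binP_le_one hy _ _) (binP_nonneg hy _ _) (binP_le_one hy _ _)

theorem abs_pairCoeff_le (s t : ℕ) {p : ℕ × ℝ} (hy : p.2 ∈ Set.Icc (0 : ℝ) 1) :
    |pairCoeff s t p| ≤ (s + 1) * (t + 1) * ((p.1.descFactorial 2 : ℝ) * p.2) := by
  have h0 : 0 ≤ (p.1.descFactorial 2 : ℝ) * p.2 := mul_nonneg (Nat.cast_nonneg _) hy.1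
  rw [pairCoeff, abs_mul, abs_of_nonneg h0, mul_comm]
  refine mul_le_mul_of_nonneg_right (abs_bicoeff_mul_le (fun s t => ?_)
    (abs_bicoeff_binXY_le hy _) s t) h0
  rw [bicoeff_monom, abs_of_nonneg (ind_nonneg _)]
  exact ind_le_one _

theorem tendsto_pairCoeff
    (hs : ∀ n, ∀ᵐ p ∂(Pn n : Measure (ℕ × ℝ)), p.1 ≤ n ∧ p.2 ∈ Set.Icc (0 : ℝ) 1)
    (hPs : ∀ᵐ p ∂(P : Measure (ℕ × ℝ)), p.2 ∈ Set.Icc (0 : ℝ) 1)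
    (hweak : Tendsto Pn atTop (𝓝 P))
    (hi : Integrable (fun p => (p.1.descFactorial 2 : ℝ) * p.2) (P : Measure (ℕ × ℝ)))
    (h21 : Tendsto (fun n => ∫ p, (p.1.descFactorial 2 : ℝ) * p.2 ∂(Pn n : Measure (ℕ × ℝ))) atTop
      (𝓝 (∫ p, (p.1.descFactorial 2 : ℝ) * p.2 ∂(P : Measure (ℕ × ℝ))))) (s t : ℕ) :
    Tendsto (fun n : ℕ => ∫ p, pairCoeff s t p ∂(Pn n : Measure (ℕ × ℝ))) atTop
      (𝓝 (∫ p, pairCoeff s t p ∂(P : Measure (ℕ × ℝ)))) :=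
  tendsto_integral_of_dominated_moment hs hPs hweak
    (φ := fun p => (p.1.descFactorial 2 : ℝ) * p.2) (fun x => by fun_prop) hi h21
    (F := fun _ => pairCoeff s t) (G := pairCoeff s t) ((s + 1) * (t + 1))
    (fun _ => continuous_pairCoeff s t) (continuous_pairCoeff s t)
    (fun _ p _ hy => abs_pairCoeff_le s t hy) (fun p hy => abs_pairCoeff_le s t hy)
    (fun K ε hε => Eventually.of_forall fun n p _ _ => by simpa using hε.le)

/-- The bivariate series with given coefficients. -/
def toBi (F : ℕ → ℕ → ℝ) : BiSeries := PowerSeries.mk fun s => PowerSeries.mk fun t => F s t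

theorem bicoeff_toBi (F : ℕ → ℕ → ℝ) (s t : ℕ) : bicoeff s t (toBi F) = F s t := by
  simp [bicoeff_def, toBi]

theorem ext_bicoeff {F G : BiSeries} (h : ∀ s t, bicoeff s t F = bicoeff s t G) : F = G := by
  ext s t
  exact h s t

theorem toBi_conv2 (F G : ℕ → ℕ → ℝ) : toBi (conv2 F G) = toBi F * toBi G := by
  refine ext_bicoeff fun s t => ?_
  rw [bicoeff_toBi, bicoeff_mul, conv2, Finset.Nat.sum_antidiagonal_eq_sum_range_succ_mk]
  refine Finset.sum_congr rfl fun i _ => ?_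
  rw [Finset.Nat.sum_antidiagonal_eq_sum_range_succ_mk]
  simp only [bicoeff_toBi]

theorem toBi_delta11 : toBi delta11 = monom 1 1 := by
  refine ext_bicoeff fun s t => ?_
  rw [bicoeff_toBi, bicoeff_monom, delta11, ind]
  simp only [eq_comm]

theorem integral_pairCoeff (hPs : ∀ᵐ p ∂(P : Measure (ℕ × ℝ)), p.2 ∈ Set.Icc (0 : ℝ) 1)
    (hi : Integrable (fun p => (p.1.descFactorial 2 : ℝ) * p.2) (P : Measure (ℕ × ℝ)))
    (h21pos : 0 < mom (P : Measure (ℕ × ℝ)) 2 1) (s t : ℕ) :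
    ∫ p, pairCoeff s t p ∂(P : Measure (ℕ × ℝ)) =
      mom (P : Measure (ℕ × ℝ)) 2 1 *
        bicoeff s t (monom 1 1 * toBi (f2p (P : Measure (ℕ × ℝ)))) := by
  have hb : ∀ u v, Integrable (fun p : ℕ × ℝ =>
      (p.1.descFactorial 2 : ℝ) * p.2 * binP (p.1 - 2) p.2 u * binP (p.1 - 2) p.2 v)
      (P : Measure (ℕ × ℝ)) := fun u v => by
    refine hi.mono' (measurable_of_continuous_sections fun x => ?_).aestronglyMeasurable
      (hPs.mono fun p hp => ?_)
    · have := continuous_binP (x - 2)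
      dsimp only
      fun_prop
    · have h := abs_bicoeff_binXY_le hp (p.1 - 2) u v
      have h0 : 0 ≤ (p.1.descFactorial 2 : ℝ) * p.2 := mul_nonneg (Nat.cast_nonneg _) hp.1
      rw [bicoeff_binXY] at h
      rw [mul_assoc, norm_mul, Real.norm_eq_abs, abs_of_nonneg h0, Real.norm_eq_abs]
      exact mul_le_of_le_one_right h0 h
  have hf : ∀ u v, ∫ p, (p.1.descFactorial 2 : ℝ) * p.2 * binP (p.1 - 2) p.2 u *
      binP (p.1 - 2) p.2 v ∂(P : Measure (ℕ × ℝ)) =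
      mom (P : Measure (ℕ × ℝ)) 2 1 * f2p (P : Measure (ℕ × ℝ)) u v := fun u v => by
    rw [f2p, mul_div_cancel₀ _ h21pos.ne']
  have e : ∀ p, pairCoeff s t p = ∑ i ∈ Finset.HasAntidiagonal.antidiagonal s,
      ∑ j ∈ Finset.HasAntidiagonal.antidiagonal t, bicoeff i.1 j.1 (monom 1 1) *
        ((p.1.descFactorial 2 : ℝ) * p.2 * binP (p.1 - 2) p.2 i.2 * binP (p.1 - 2) p.2 j.2) := by
    intro p
    simp only [pairCoeff, bicoeff_mul, bicoeff_binXY, Finset.mul_sum]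
    refine Finset.sum_congr rfl fun i _ => Finset.sum_congr rfl fun j _ => ?_
    ring
  simp only [e]
  rw [integral_finsetSum _ fun i _ => integrable_finsetSum _ fun j _ => (hb _ _).const_mul _,
    bicoeff_mul, Finset.mul_sum]
  refine Finset.sum_congr rfl fun i _ => ?_
  rw [integral_finsetSum _ fun j _ => (hb _ _).const_mul _, Finset.mul_sum]
  refine Finset.sum_congr rfl fun j _ => ?_
  rw [integral_const_mul, hf, bicoeff_toBi]
  ring

theorem tendsto_tripleMoment
    (hs : ∀ n, ∀ᵐ p ∂(Pn n : Measure (ℕ × ℝ)), p.1 ≤ n ∧ p.2 ∈ Set.Icc (0 : ℝ) 1)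
    (hPs : ∀ᵐ p ∂(P : Measure (ℕ × ℝ)), p.2 ∈ Set.Icc (0 : ℝ) 1)
    (hweak : Tendsto Pn atTop (𝓝 P))
    (hi : Integrable (fun p => (p.1.descFactorial 2 : ℝ) * p.2) (P : Measure (ℕ × ℝ)))
    (h21 : Tendsto (fun n => ∫ p, (p.1.descFactorial 2 : ℝ) * p.2 ∂(Pn n : Measure (ℕ × ℝ))) atTop
      (𝓝 (∫ p, (p.1.descFactorial 2 : ℝ) * p.2 ∂(P : Measure (ℕ × ℝ))))) :
    Tendsto (fun n : ℕ => ∫ p, (p.1.descFactorial 3 : ℝ) * p.2 ^ 2 / ((n : ℝ) - 2)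
      ∂(Pn n : Measure (ℕ × ℝ))) atTop (𝓝 0) := by
  have hd : ∀ x : ℕ, x.descFactorial 3 = (x - 2) * x.descFactorial 2 := fun x =>
    Nat.descFactorial_succ x 2
  have h := tendsto_integral_of_dominated_moment hs hPs hweak
    (φ := fun p => (p.1.descFactorial 2 : ℝ) * p.2) (fun x => by fun_prop) hi h21
    (F := fun n p => (p.1.descFactorial 3 : ℝ) * p.2 ^ 2 / ((n : ℝ) - 2)) (G := fun _ => 0) 1
    (fun _ _ => by fun_prop) (fun _ => continuous_const)
    (fun n p hx hy => by
      have h0 : 0 ≤ (p.1.descFactorial 2 : ℝ) * p.2 := mul_nonneg (Nat.cast_nonneg _) hy.1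
      rw [one_mul]
      rcases lt_or_ge 2 n with hn | hn
      · have hn' : (0 : ℝ) < (n : ℝ) - 2 := by
          have : (2 : ℝ) < n := by exact_mod_cast hn
          linarith
        have hx' : ((p.1 - 2 : ℕ) : ℝ) ≤ (n : ℝ) - 2 := by
          rw [← Nat.cast_ofNat (R := ℝ), ← Nat.cast_sub hn.le]
          exact_mod_cast Nat.sub_le_sub_right hx 2
        rw [abs_of_nonneg (div_nonneg (by positivity) hn'.le), div_le_iff₀ hn', hd, Nat.cast_mul]
        have h1 := mul_le_mul_of_nonneg_left hx' h0
        have h2 := mul_le_mul_of_nonneg_left hy.2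
          (mul_nonneg (Nat.cast_nonneg (α := ℝ) (p.1 - 2)) h0)
        nlinarith
      · rw [Nat.descFactorial_eq_zero_iff_lt.2 (by lia : p.1 < 3)]
        simpa using h0)
    (fun p hy => by
      have h0 : 0 ≤ (p.1.descFactorial 2 : ℝ) * p.2 := mul_nonneg (Nat.cast_nonneg _) hy.1
      simpa using h0)
    (fun K ε hε => by
      have h1 := (tendsto_const_div_sub ((K : ℝ) ^ 3) 2).eventually (gt_mem_nhds hε)
      filter_upwards [h1, eventually_gt_atTop 2] with n h1 hn p hx hy
      have hn' : (0 : ℝ) < (n : ℝ) - 2 := by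
        have : (2 : ℝ) < n := by exact_mod_cast hn
        linarith
      rw [sub_zero, abs_of_nonneg (div_nonneg (by positivity) hn'.le)]
      refine le_trans (div_le_div_of_nonneg_right ?_ hn'.le) h1.le
      have h3 : (p.1.descFactorial 3 : ℝ) ≤ (K : ℝ) ^ 3 := by
        exact_mod_cast (Nat.descFactorial_le_pow _ _).trans (Nat.pow_le_pow_left hx 3)
      have h4 : p.2 ^ 2 ≤ 1 := pow_le_one₀ hy.1 hy.2
      calc _ ≤ (K : ℝ) ^ 3 * 1 := mul_le_mul h3 h4 (sq_nonneg _) (by positivity)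
        _ = _ := mul_one _)
  simpa using h

end Limits

section Assembly

theorem condMean_mem {n : ℕ} {p : ℕ × ℝ} (hx : p.1 ≤ n) (hy : p.2 ∈ Set.Icc (0 : ℝ) 1)
    {a b : Fin n} (hab : a ≠ b) :
    condMean n p (fun E => ind (s(a, b) ∈ E)) =
      (p.1.descFactorial 2 : ℝ) / n.descFactorial 2 * p.2 := by
  have h := condMean_subset hy {s(a, b)}
  have hT : ∀ V : Finset (Fin n), (∀ e ∈ ({s(a, b)} : Finset (Sym2 (Fin n))), Valid V e) ↔
      {a, b} ⊆ V := fun V => by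
    simp [Valid, hab, Finset.insert_subset_iff]
  have h2 := sum_vertexMeasure_subset hx {a, b}
  rw [Finset.card_pair hab] at h2
  simp only [Finset.singleton_subset_iff, hT, Finset.card_singleton, pow_one] at h
  rw [h, ← h2, Finset.sum_mul]
  refine Finset.sum_congr rfl fun V _ => ?_
  ring

variable {n : ℕ} {Q : Measure (ℕ × ℝ)} [IsProbabilityMeasure Q] {a b : Fin n}

theorem mean_edgeLaw_mem (hQ : ∀ᵐ p ∂Q, p.1 ≤ n ∧ p.2 ∈ Set.Icc (0 : ℝ) 1) (hab : a ≠ b) :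
    mean (edgeLaw n Q) (fun E => ind (s(a, b) ∈ E)) =
      (∫ p, (p.1.descFactorial 2 : ℝ) * p.2 ∂Q) / n.descFactorial 2 := by
  rw [mean_edgeLaw, ← integral_div]
  refine integral_congr_ae (hQ.mono fun p hp => ?_)
  dsimp only
  rw [condMean_mem hp.1 hp.2 hab]
  ring

theorem mean_edgeLaw_mem_le (hQ : ∀ᵐ p ∂Q, p.1 ≤ n ∧ p.2 ∈ Set.Icc (0 : ℝ) 1)
    (e : Sym2 (Fin n)) :
    mean (edgeLaw n Q) (fun E => ind (e ∈ E)) ≤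
      (∫ p, (p.1.descFactorial 2 : ℝ) * p.2 ∂Q) / n.descFactorial 2 := by
  rw [mean_edgeLaw, ← integral_div]
  refine integral_mono_ae (integrable_condMean_ind Q _)
    (integrable_of_support hQ fun x => by dsimp only; fun_prop) (hQ.mono fun p hp => ?_)
  refine (condMean_mem_le hp.1 hp.2 e).trans (le_of_eq ?_)
  ring

theorem mean_edgeLaw_mem_mem_le (hQ : ∀ᵐ p ∂Q, p.1 ≤ n ∧ p.2 ∈ Set.Icc (0 : ℝ) 1) (hab : a ≠ b)
    {e : Sym2 (Fin n)} (he : e ∈ touching a b) :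
    mean (edgeLaw n Q) (fun E => ind (s(a, b) ∈ E ∧ e ∈ E)) ≤
      (∫ p, (p.1.descFactorial 3 : ℝ) * p.2 ^ 2 ∂Q) / n.descFactorial 3 := by
  rw [mean_edgeLaw, ← integral_div]
  refine integral_mono_ae (integrable_condMean_ind Q _)
    (integrable_of_support hQ fun x => by dsimp only; fun_prop) (hQ.mono fun p hp => ?_)
  refine (condMean_mem_mem_le hp.1 hp.2 hab he).trans (le_of_eq ?_)
  ring

/-- The joint degree generating function of a random layer. -/
def degSeries (n : ℕ) (Q : Measure (ℕ × ℝ)) : BiSeries := toBi fun s t => ∫ p, degCoeff n s t p ∂Q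

/-- The joint degree generating function of a random layer on the event of a given edge. -/
def pairSeries (n : ℕ) (Q : Measure (ℕ × ℝ)) : BiSeries :=
  toBi fun s t => (∫ p, pairCoeff s t p ∂Q) / n.descFactorial 2

theorem jointGF_one_eq (hQ : ∀ᵐ p ∂Q, p.1 ≤ n ∧ p.2 ∈ Set.Icc (0 : ℝ) 1) (hab : a ≠ b) :
    jointGF (edgeLaw n Q) (edgeDeg a) (edgeDeg b) (fun _ => 1) = degSeries n Q := by
  refine ext_bicoeff fun s t => ?_
  rw [bicoeff_jointGF, degSeries, bicoeff_toBi]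
  simp only [one_mul]
  rw [mean_edgeLaw]
  exact integral_congr_ae (hQ.mono fun p hp => condMean_deg hab hp.1 hp.2 s t)

theorem jointGF_mem_eq (hQ : ∀ᵐ p ∂Q, p.1 ≤ n ∧ p.2 ∈ Set.Icc (0 : ℝ) 1) (hab : a ≠ b) :
    jointGF (edgeLaw n Q) (edgeDeg a) (edgeDeg b) (fun E => ind (s(a, b) ∈ E)) =
      pairSeries n Q := by
  refine ext_bicoeff fun s t => ?_
  rw [bicoeff_jointGF, pairSeries, bicoeff_toBi, mean_edgeLaw, ← integral_div]
  refine integral_congr_ae (hQ.mono fun p hp => ?_)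
  dsimp only
  rw [condMean_adj_deg hab hp.1 hp.2 s t, pairCoeff]
  ring

/-- Bound for the probability that two layers interfere near a given edge. -/
def overlapBound (n m : ℕ) (Q : Measure (ℕ × ℝ)) : ℝ :=
  let p := (∫ p, (p.1.descFactorial 2 : ℝ) * p.2 ∂Q) / n.descFactorial 2
  let q := (∫ p, (p.1.descFactorial 3 : ℝ) * p.2 ^ 2 ∂Q) / n.descFactorial 3
  (m : ℝ) ^ 2 * p ^ 2 + (m : ℝ) ^ 2 * (2 * n) * (q * p + m * p ^ 3)

theorem prodMean_overlap_le_overlapBound (m : ℕ)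
    (hQ : ∀ᵐ p ∂Q, p.1 ≤ n ∧ p.2 ∈ Set.Icc (0 : ℝ) 1) (hab : a ≠ b) :
    prodMean (edgeLaw n Q) m (overlap a b) ≤ overlapBound n m Q :=
  prodMean_overlap_le (edgeLaw_nonneg Q) (sum_edgeLaw Q)
    (div_nonneg (integral_nonneg_of_ae (hQ.mono fun p _ => by
      dsimp only [Pi.zero_apply]; positivity)) (Nat.cast_nonneg _))
    (mean_edgeLaw_mem_le hQ) fun _ he => mean_edgeLaw_mem_mem_le hQ hab he

theorem abs_prodMean_adj_deg_sub_le (m : ℕ)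
    (hQ : ∀ᵐ p ∂Q, p.1 ≤ n ∧ p.2 ∈ Set.Icc (0 : ℝ) 1) (hab : a ≠ b) (s t : ℕ) :
    |prodMean (edgeLaw n Q) m (fun E => ind (s(a, b) ∈ Finset.univ.biUnion E ∧
        edgeDeg a (Finset.univ.biUnion E) = s ∧ edgeDeg b (Finset.univ.biUnion E) = t)) -
      m * bicoeff s t (pairSeries n Q * degSeries n Q ^ (m - 1))| ≤ overlapBound n m Q := by
  refine le_trans (le_of_eq ?_) ((abs_prodMean_sub_le (edgeLaw_nonneg Q)
    fun E => abs_ind_deg_sub_le a b E s t).trans (prodMean_overlap_le_overlapBound m hQ hab))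
  congr 2
  rw [prodMean_sum]
  rw [Finset.sum_congr rfl fun k _ => prodMean_jointGF k (edgeDeg a) (edgeDeg b)
    (fun E => ind (s(a, b) ∈ E)) s t, jointGF_one_eq hQ hab, jointGF_mem_eq hQ hab]
  simp

theorem abs_prodMean_adj_sub_le (m : ℕ)
    (hQ : ∀ᵐ p ∂Q, p.1 ≤ n ∧ p.2 ∈ Set.Icc (0 : ℝ) 1) (hab : a ≠ b) :
    |prodMean (edgeLaw n Q) m (fun E => ind (s(a, b) ∈ Finset.univ.biUnion E)) -
      m * ((∫ p, (p.1.descFactorial 2 : ℝ) * p.2 ∂Q) / n.descFactorial 2)| ≤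
        overlapBound n m Q := by
  refine le_trans (le_of_eq ?_) ((abs_prodMean_sub_le (edgeLaw_nonneg Q)
    fun E => abs_ind_adj_sub_le a b E (x := True) (y := True) fun _ h => absurd Iff.rfl h).trans
      (prodMean_overlap_le_overlapBound m hQ hab))
  simp only [and_true, ind_true, mul_one]
  congr 2
  rw [prodMean_sum, Finset.sum_congr rfl fun k _ => prodMean_one (sum_edgeLaw Q) k
    (fun E => ind (s(a, b) ∈ E)), mean_edgeLaw_mem hQ hab]
  simp

end Assembly

section Conclusion

theorem ae_of_measure_eq_one {Q : Measure (ℕ × ℝ)} [IsProbabilityMeasure Q] {A : Set (ℕ × ℝ)}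
    (hA : MeasurableSet A) (h : Q A = 1) : ∀ᵐ p ∂Q, p ∈ A :=
  (mem_ae_iff_prob_eq_one hA).2 h

theorem tendsto_sq_div_descFactorial_two :
    Tendsto (fun n : ℕ => (n : ℝ) ^ 2 / n.descFactorial 2) atTop (𝓝 1) := by
  have h := (tendsto_const_div_sub 1 1).const_add (1 : ℝ)
  rw [add_zero] at h
  refine h.congr' ?_
  filter_upwards [eventually_ge_atTop 2] with n hn
  have hn' : (2 : ℝ) ≤ n := by exact_mod_cast hn
  have h1 : (n : ℝ) - 1 ≠ 0 := by linarith
  have h2 : (n : ℝ) ≠ 0 := by linarith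
  rw [Nat.cast_descFactorial_two]
  field_simp
  ring

variable {mu : ℝ} {m : ℕ → ℕ} {Pn : ℕ → ProbabilityMeasure (ℕ × ℝ)} {P : ProbabilityMeasure (ℕ × ℝ)}

theorem tendsto_overlapBound (hratio : Tendsto (fun n : ℕ => (m n : ℝ) / n) atTop (𝓝 mu)) {c : ℝ}
    (h21 : Tendsto (fun n => ∫ p, (p.1.descFactorial 2 : ℝ) * p.2 ∂(Pn n : Measure (ℕ × ℝ))) atTop
      (𝓝 c))
    (h3 : Tendsto (fun n : ℕ => ∫ p, (p.1.descFactorial 3 : ℝ) * p.2 ^ 2 / ((n : ℝ) - 2)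
      ∂(Pn n : Measure (ℕ × ℝ))) atTop (𝓝 0)) :
    Tendsto (fun n : ℕ => (n : ℝ) * overlapBound n (m n) (Pn n)) atTop (𝓝 0) := by
  have hr := tendsto_sq_div_descFactorial_two
  have hp := hr.mul h21
  have hq := hr.mul h3
  have hi := tendsto_const_div_sub 1 0
  have h := ((((hratio.pow 2).mul (hp.pow 2)).mul hi).add
    (((hratio.pow 2).mul (hq.mul hp)).const_mul 2)).add
    ((((hratio.pow 3).mul (hp.pow 3)).mul hi).const_mul 2)
  simp only [mul_zero, zero_mul, add_zero] at h
  refine h.congr' ?_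
  filter_upwards [eventually_ge_atTop 3] with n hn
  have hn' : (3 : ℝ) ≤ n := by exact_mod_cast hn
  have h1 : (n : ℝ) - 1 ≠ 0 := by linarith
  have h2 : (n : ℝ) - 2 ≠ 0 := by linarith
  have h0 : (n : ℝ) ≠ 0 := by linarith
  have hd : (n.descFactorial 3 : ℝ) = (n - 2) * (n * (n - 1)) := by
    rw [Nat.descFactorial_succ n 2, Nat.cast_mul, Nat.cast_descFactorial_two,
      Nat.cast_sub (by lia), Nat.cast_ofNat]
  simp only [overlapBound, hd, Nat.cast_descFactorial_two, integral_div, sub_zero]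
  field_simp
  ring

theorem tendsto_bicoeff_pairSeries_mul_pow (hmu : 0 < mu)
    (hratio : Tendsto (fun n : ℕ => (m n : ℝ) / n) atTop (𝓝 mu))
    (hs : ∀ n, ∀ᵐ p ∂(Pn n : Measure (ℕ × ℝ)), p.1 ≤ n ∧ p.2 ∈ Set.Icc (0 : ℝ) 1)
    (hPs : ∀ᵐ p ∂(P : Measure (ℕ × ℝ)), p.2 ∈ Set.Icc (0 : ℝ) 1)
    (hweak : Tendsto Pn atTop (𝓝 P))
    (hi10 : Integrable (fun p => (p.1 : ℝ)) (P : Measure (ℕ × ℝ)))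
    (hi21 : Integrable (fun p => (p.1.descFactorial 2 : ℝ) * p.2) (P : Measure (ℕ × ℝ)))
    (h10pos : 0 < mom (P : Measure (ℕ × ℝ)) 1 0)
    (h21pos : 0 < mom (P : Measure (ℕ × ℝ)) 2 1)
    (h10 : Tendsto (fun n => ∫ p, (p.1 : ℝ) ∂(Pn n : Measure (ℕ × ℝ))) atTop
      (𝓝 (∫ p, (p.1 : ℝ) ∂(P : Measure (ℕ × ℝ)))))
    (h21 : Tendsto (fun n => ∫ p, (p.1.descFactorial 2 : ℝ) * p.2 ∂(Pn n : Measure (ℕ × ℝ))) atTop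
      (𝓝 (∫ p, (p.1.descFactorial 2 : ℝ) * p.2 ∂(P : Measure (ℕ × ℝ))))) (s t : ℕ) :
    Tendsto (fun n : ℕ => (n : ℝ) ^ 2 *
        bicoeff s t (pairSeries n (Pn n) * degSeries n (Pn n) ^ (m n - 1))) atTop
      (𝓝 (mom (P : Measure (ℕ × ℝ)) 2 1 * barf2 mu P s t)) := by
  have hk : Tendsto (fun n : ℕ => ((m n - 1 : ℕ) : ℝ) / n) atTop (𝓝 mu) := by
    have h := hratio.sub (tendsto_const_div_sub 1 0)
    rw [sub_zero] at h
    refine h.congr' ?_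
    filter_upwards [hratio.eventually (lt_mem_nhds hmu)] with n hn
    have hm : 1 ≤ m n := by
      by_contra hm
      rw [not_le, Nat.lt_one_iff] at hm
      simp [hm] at hn
    rw [Nat.cast_sub hm, Nat.cast_one, sub_div, sub_zero]
  have hpow : ∀ s t, Tendsto (fun n => bicoeff s t (degSeries n (Pn n) ^ (m n - 1))) atTop
      (𝓝 (bicoeff s t (toBi fun s t => barf1 mu P s * barf1 mu P t))) := fun s t => by
    rw [bicoeff_toBi]
    refine tendsto_bicoeff_pow_cpoi hmu (fun s t => ?_) hk s t
    rw [← integral_degSlope hPs hi10 h10pos]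
    simp only [map_sub, degSeries, bicoeff_toBi]
    exact tendsto_degCoeff hs hPs hweak hi10 h10 s t
  have hpair : ∀ s t, Tendsto (fun n : ℕ => bicoeff s t
      (scalar ((n : ℝ) ^ 2) * pairSeries n (Pn n))) atTop
      (𝓝 (bicoeff s t (scalar (mom (P : Measure (ℕ × ℝ)) 2 1) *
        (monom 1 1 * toBi (f2p (P : Measure (ℕ × ℝ))))))) := fun s t => by
    rw [bicoeff_scalar_mul, ← integral_pairCoeff hPs hi21 h21pos]
    have h := tendsto_sq_div_descFactorial_two.mul (tendsto_pairCoeff hs hPs hweak hi21 h21 s t)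
    rw [one_mul] at h
    refine h.congr fun n => ?_
    rw [bicoeff_scalar_mul, pairSeries, bicoeff_toBi]
    ring
  have h := tendsto_bicoeff_mul hpair hpow s t
  have hb : toBi (barf2 mu P) = monom 1 1 * (toBi fun s t => barf1 mu P s * barf1 mu P t) *
      toBi (f2p (P : Measure (ℕ × ℝ))) := by
    rw [barf2, toBi_conv2, toBi_conv2, toBi_delta11]
  rw [← bicoeff_toBi (barf2 mu P) s t, hb, ← bicoeff_scalar_mul]
  simp only [mul_assoc, bicoeff_scalar_mul] at h ⊢
  rwa [mul_comm (toBi (f2p (P : Measure (ℕ × ℝ))))] at h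

theorem tendsto_of_abs_sub_le {F G B : ℕ → ℝ} {c : ℝ} (hG : Tendsto G atTop (𝓝 c))
    (hB : Tendsto B atTop (𝓝 0)) (h : ∀ᶠ n in atTop, |F n - G n| ≤ B n) :
    Tendsto F atTop (𝓝 c) := by
  have h1 := squeeze_zero_norm' (a := B) (f := fun n => F n - G n) h hB
  simpa using h1.add hG

end Conclusion

/-- **Theorem 1(i)** (Bloznelis–Karjalainen–Leskelä).
If `m/n → μ ∈ (0,∞)`, the layer type distributions `P⁽ⁿ⁾` converge weakly to `P`, and the
cross moments `P⁽ⁿ⁾₁₀ → P₁₀ ∈ (0,∞)`, `P⁽ⁿ⁾₂₁ → P₂₁ ∈ (0,∞)`, then the model bidegree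
distribution `f_{2,n}` converges weakly to `\bar f₂ = δ₍₁,₁₎ ∗ (\bar f₁ ⊗ \bar f₁) ∗ f₂'`. -/
theorem bidegree_tendsto_barf2
    (mu : ℝ) (hmu : 0 < mu)
    (m : ℕ → ℕ) (hm : Tendsto m atTop atTop)
    (hratio : Tendsto (fun n : ℕ => (m n : ℝ) / n) atTop (𝓝 mu))
    (Pn : ℕ → ProbabilityMeasure (ℕ × ℝ)) (P : ProbabilityMeasure (ℕ × ℝ))
    (hsupp : ∀ n, (Pn n : Measure (ℕ × ℝ)) {p : ℕ × ℝ | p.1 ≤ n ∧ p.2 ∈ Set.Icc (0:ℝ) 1} = 1)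
    (hPsupp : (P : Measure (ℕ × ℝ)) {p : ℕ × ℝ | p.2 ∈ Set.Icc (0:ℝ) 1} = 1)
    (hweak : Tendsto Pn atTop (𝓝 P))
    (hint10 : Integrable (fun p : ℕ × ℝ => (p.1.descFactorial 1 : ℝ) * p.2 ^ (0:ℕ))
      (P : Measure (ℕ × ℝ)))
    (hint21 : Integrable (fun p : ℕ × ℝ => (p.1.descFactorial 2 : ℝ) * p.2 ^ (1:ℕ))
      (P : Measure (ℕ × ℝ)))
    (h10pos : 0 < mom (P : Measure (ℕ × ℝ)) 1 0)
    (h21pos : 0 < mom (P : Measure (ℕ × ℝ)) 2 1)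
    (h10 : Tendsto (fun n : ℕ => mom (Pn n : Measure (ℕ × ℝ)) 1 0) atTop
      (𝓝 (mom (P : Measure (ℕ × ℝ)) 1 0)))
    (h21 : Tendsto (fun n : ℕ => mom (Pn n : Measure (ℕ × ℝ)) 2 1) atTop
      (𝓝 (mom (P : Measure (ℕ × ℝ)) 2 1))) :
    ∀ s t : ℕ, Tendsto (fun n : ℕ => bidegree n (m n) (Pn n : Measure (ℕ × ℝ)) s t) atTop
      (𝓝 (barf2 mu (P : Measure (ℕ × ℝ)) s t)) := by
  intro s t
  have hS : MeasurableSet {p : ℕ × ℝ | p.2 ∈ Set.Icc (0 : ℝ) 1} :=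
    measurable_snd measurableSet_Icc
  have hs : ∀ n, ∀ᵐ p ∂(Pn n : Measure (ℕ × ℝ)), p.1 ≤ n ∧ p.2 ∈ Set.Icc (0 : ℝ) 1 := fun n =>
    ae_of_measure_eq_one ((measurable_fst (measurableSet_Iic (a := n))).inter hS) (hsupp n)
  have hPs : ∀ᵐ p ∂(P : Measure (ℕ × ℝ)), p.2 ∈ Set.Icc (0 : ℝ) 1 :=
    ae_of_measure_eq_one hS hPsupp
  have e10 : ∀ Q : Measure (ℕ × ℝ), mom Q 1 0 = ∫ p, (p.1 : ℝ) ∂Q := fun Q => by simp [mom]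
  have e21 : ∀ Q : Measure (ℕ × ℝ), mom Q 2 1 = ∫ p, (p.1.descFactorial 2 : ℝ) * p.2 ∂Q :=
    fun Q => by simp only [mom, pow_one]
  simp only [Nat.descFactorial_one, pow_zero, mul_one] at hint10
  simp only [pow_one] at hint21
  simp only [e10] at h10
  simp only [e21] at h21
  have hB := tendsto_overlapBound hratio h21 (tendsto_tripleMoment hs hPs hweak hint21 h21)
  have hnum := hratio.mul (tendsto_bicoeff_pairSeries_mul_pow hmu hratio hs hPs hweak hint10 hint21
    h10pos h21pos h10 h21 s t)
  have hden := hratio.mul (tendsto_sq_div_descFactorial_two.mul h21)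
  rw [one_mul, ← e21] at hden
  let N : ℕ → ℝ := fun n => if hn : 2 ≤ n then
    n * prodMean (edgeLaw n (Pn n)) (m n) (fun E =>
      ind (s((⟨0, by lia⟩ : Fin n), ⟨1, by lia⟩) ∈ Finset.univ.biUnion E ∧
        edgeDeg ⟨0, by lia⟩ (Finset.univ.biUnion E) = s ∧
        edgeDeg ⟨1, by lia⟩ (Finset.univ.biUnion E) = t)) else 0
  let D : ℕ → ℝ := fun n => if hn : 2 ≤ n then
    n * prodMean (edgeLaw n (Pn n)) (m n) (fun E =>
      ind (s((⟨0, by lia⟩ : Fin n), ⟨1, by lia⟩) ∈ Finset.univ.biUnion E)) else 0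
  have hN : Tendsto N atTop (𝓝 (mu * (mom (P : Measure (ℕ × ℝ)) 2 1 * barf2 mu P s t))) := by
    refine tendsto_of_abs_sub_le hnum hB ?_
    filter_upwards [eventually_ge_atTop 2] with n hn
    have hn0 : (n : ℝ) ≠ 0 := by positivity
    have h := mul_le_mul_of_nonneg_left (abs_prodMean_adj_deg_sub_le (m n) (hs n)
      (a := ⟨0, by lia⟩) (b := ⟨1, by lia⟩) (by simp) s t) (Nat.cast_nonneg (α := ℝ) n)
    refine le_trans (le_of_eq ?_) h
    simp only [N, dif_pos hn]
    rw [← Nat.abs_cast n, ← abs_mul, Nat.abs_cast, mul_sub]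
    congr 2
    field_simp
  have hD : Tendsto D atTop (𝓝 (mu * mom (P : Measure (ℕ × ℝ)) 2 1)) := by
    refine tendsto_of_abs_sub_le hden hB ?_
    filter_upwards [eventually_ge_atTop 2] with n hn
    have hn0 : (n : ℝ) ≠ 0 := by positivity
    have h := mul_le_mul_of_nonneg_left (abs_prodMean_adj_sub_le (m n) (hs n)
      (a := ⟨0, by lia⟩) (b := ⟨1, by lia⟩) (by simp)) (Nat.cast_nonneg (α := ℝ) n)
    refine le_trans (le_of_eq ?_) h
    simp only [D, dif_pos hn]
    rw [← Nat.abs_cast n, ← abs_mul, Nat.abs_cast, mul_sub]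
    congr 2
    field_simp
  have h := hN.div hD (mul_pos hmu h21pos).ne'
  have e : mu * (mom (P : Measure (ℕ × ℝ)) 2 1 * barf2 mu P s t) /
      (mu * mom (P : Measure (ℕ × ℝ)) 2 1) = barf2 mu P s t := by
    have := h21pos.ne'
    field_simp
  rw [e] at h
  refine h.congr' ?_
  filter_upwards [eventually_ge_atTop 2] with n hn
  have hn0 : (n : ℝ) ≠ 0 := by positivity
  rw [bidegree_eq_div hn (m n) (Pn n) rfl rfl s t]
  simp only [N, D, dif_pos hn, Pi.div_apply]
  exact mul_div_mul_left _ _ hn0
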